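/- Let F be a finite field with q elements and characteristic p (p odd). Let k ≥ 1 and let b₁ < b₂ < ... < b_k be strictly increasing integers (possibly negative) each coprime with p (p ∤ b_i), and set d := max(b_k, 0) − min(b₁, 0) + 1. Then for any elements a₁, ..., a_k of F and M chosen uniformly at random from GL_n(F) (the group of invertible n×n matrices over F), | Pr[ trace(M^{b_i}) = a_i for all 1 ≤ i ≤ k ] − q^{−k} | ≤ q^{−n²/(2d)} · (1 + 1/(q−1))^n · binom(n+d, n), where M^{b_i} denotes the b_i-th power of M in the group GL_n(F) (so negative exponents use M⁻¹) and trace is the matrix trace. -/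

import Mathlib

namespace TracePowers

open Polynomial

section Valuation

variable {E L Γ : Type*} [Field E] [Field L] [Algebra E L] [LinearOrderedCommGroupWithZero Γ]

/-- A transcendental element has a place at infinity. -/
theorem exists_valuation_one_lt {x : L} (hx : Transcendental E x) :
    ∃ V : ValuationSubring L, V.valuation.IsTrivialOn E ∧ 1 < V.valuation x := by
  have hx0 : x ≠ 0 := fun h => hx (h ▸ isAlgebraic_zero)
  have hxi : Transcendental E x⁻¹ := by rwa [Transcendental, IsAlgebraic.inv_iff]
  let A : Subring L := (Algebra.adjoin E {x⁻¹}).toSubring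
  have hmem : x⁻¹ ∈ A := Algebra.subset_adjoin rfl
  let I : Ideal A := Ideal.span {⟨x⁻¹, hmem⟩}
  have hI : I ≠ ⊤ := by
    intro h
    obtain ⟨⟨y, hy⟩, hyx⟩ := Ideal.mem_span_singleton'.mp ((Ideal.eq_top_iff_one I).mp h)
    have hy' : y ∈ Algebra.adjoin E {x⁻¹} := hy
    rw [Algebra.adjoin_singleton_eq_range_aeval] at hy'
    obtain ⟨r, hr⟩ := hy'
    have h1 : y * x⁻¹ = 1 := congrArg Subtype.val hyx
    refine hxi ⟨r * X - 1, ?_, ?_⟩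
    · intro h0
      have := congrArg (coeff · 0) h0
      simp at this
    · simp only [map_sub, map_mul, aeval_X, map_one]
      rw [← h1, ← hr]
      simp
  obtain ⟨V, hAV, hIV⟩ := Ideal.image_subset_nonunits_valuationSubring I hI
  refine ⟨V, ⟨fun c hc => ?_⟩, ?_⟩
  · have hle : ∀ c : E, V.valuation (algebraMap E L c) ≤ 1 := fun c =>
      (V.valuation_le_one_iff _).mpr (hAV (Subalgebra.algebraMap_mem _ c))
    refine le_antisymm (hle c) ?_
    have h2 := hle c⁻¹
    rw [map_inv₀, map_inv₀] at h2
    exact (inv_le_one₀ (by simpa [zero_lt_iff] using hc)).mp h2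
  · have h1 : V.valuation x⁻¹ < 1 :=
      V.mem_nonunits_iff.mp (hIV ⟨⟨x⁻¹, hmem⟩, Ideal.mem_span_singleton_self _, rfl⟩)
    rw [map_inv₀] at h1
    exact (inv_lt_one₀ (by simpa [zero_lt_iff] using hx0)).mp h1

theorem le_valuation_sum {ι : Type*} (v : Valuation L Γ) (s : Finset ι) (f : ι → L)
    (hinj : Set.InjOn (fun i => v (f i)) s) {i : ι} (hi : i ∈ s) :
    v (f i) ≤ v (∑ j ∈ s, f j) := by
  classical
  obtain ⟨j, hj, hmax⟩ := s.exists_max_image (fun i => v (f i)) ⟨i, hi⟩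
  rw [Valuation.map_sum_eq_of_lt v hj]
  · exact hmax i hi
  · intro k hk
    simp only [Finset.mem_sdiff, Finset.mem_singleton] at hk
    exact lt_of_le_of_ne (hmax k hk.1) fun h => hk.2 (hinj hk.1 hj h)

/-- Evaluation of a bivariate polynomial at a pair. -/
noncomputable def biEval (E : Type*) {L : Type*} [Field E] [Field L] [Algebra E L] (x z : L) :
    E[X][X] →+* L :=
  eval₂RingHom (aeval x : E[X] →ₐ[E] L).toRingHom z

theorem biEval_eq_sum (x z : L) (R : E[X][X]) :
    biEval E x z R = ∑ j ∈ R.support, aeval x (R.coeff j) * z ^ j := by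
  simp [biEval, eval₂_eq_sum, Polynomial.sum]

@[simp]
theorem biEval_C (x z : L) (r : E[X]) : biEval E x z (C r) = aeval x r := by simp [biEval]

@[simp]
theorem biEval_X (x z : L) : biEval E x z X = z := by simp [biEval]

variable (v : Valuation L Γ)

theorem weight_injOn {q D : ℕ} (hcop : q.Coprime D) {i j i' j' : ℕ} (hj : j < q) (hj' : j' < q)
    (h : q * i + D * j = q * i' + D * j') : i = i' ∧ j = j' := by
  have hmod : D * j ≡ D * j' [MOD q] := by
    have h1 : q * i + D * j ≡ q * i' + D * j' [MOD q] := by rw [h]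
    have h2 : ∀ a b, q * a + b ≡ b [MOD q] := fun a b => by simp [Nat.ModEq]
    exact ((h2 _ _).symm.trans h1).trans (h2 _ _)
  have hjj : j = j' :=
    Nat.ModEq.eq_of_lt_of_lt (Nat.ModEq.cancel_left_of_coprime hcop hmod) hj hj'
  subst hjj
  exact ⟨Nat.eq_of_mul_eq_mul_left (by omega) (Nat.add_right_cancel h), rfl⟩

variable [v.IsTrivialOn E]

theorem le_valuation_biEval {q D : ℕ} (hcop : q.Coprime D) {x z : L} (hx : 1 < v x)
    (hz : v z ^ q = v x ^ D) {R : E[X][X]} (hR : R.natDegree < q) {j : ℕ} (hj : R.coeff j ≠ 0) :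
    v x ^ (q * (R.coeff j).natDegree + D * j) ≤ v (biEval E x z R) ^ q := by
  have hterm : ∀ i ∈ R.support, v (aeval x (R.coeff i) * z ^ i) ^ q =
      v x ^ (q * (R.coeff i).natDegree + D * i) := by
    intro i hi
    rw [map_mul, valuation_aeval_eq_valuation_X_pow_natDegree_of_one_lt_valuation_X x hx
      (mem_support_iff.mp hi), map_pow, mul_pow, ← pow_mul, ← pow_mul, mul_comm i q, pow_mul (v z),
      hz, ← pow_mul, ← pow_add, mul_comm q]
  have hjs : j ∈ R.support := mem_support_iff.mpr hj
  rw [← hterm j hjs, biEval_eq_sum]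
  refine pow_le_pow_left₀ zero_le (le_valuation_sum v _
    (fun i => aeval x (R.coeff i) * z ^ i) ?_ hjs) q
  intro i hi i' hi' h
  have h2 := congrArg (· ^ q) h
  simp only [hterm i hi, hterm i' hi'] at h2
  exact (weight_injOn hcop ((le_natDegree_of_mem_supp i hi).trans_lt hR)
    ((le_natDegree_of_mem_supp i' hi').trans_lt hR)
    (pow_right_injective₀ (zero_lt_one.trans hx) hx.ne' h2)).2

theorem valuation_artinSchreier_root {q B D : ℕ} (hq : 2 ≤ q) (hBD : q * B < D) {x z : L}
    (hx : 1 < v x) {g : E[X]} (hg : g.natDegree = D)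
    (hz : z ^ q = x ^ (B * (q - 1)) * z + aeval x g) : v z ^ q = v x ^ D := by
  have hg0 : g ≠ 0 := by rintro rfl; simp at hg; omega
  have hvg : v (aeval x g) = v x ^ D := by
    rw [valuation_aeval_eq_valuation_X_pow_natDegree_of_one_lt_valuation_X x hx hg0, hg]
  have hx0 : 0 < v x := zero_lt_one.trans hx
  have hzq : v (z ^ q) = v z ^ q := map_pow v z q
  have hxz : v (x ^ (B * (q - 1)) * z) = v x ^ (B * (q - 1)) * v z := by simp
  obtain ⟨r, rfl⟩ : ∃ r, q = r + 1 := ⟨q - 1, by omega⟩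
  simp only [Nat.add_sub_cancel] at *
  have hr : r ≠ 0 := by omega
  rcases lt_trichotomy (v z ^ (r + 1)) (v x ^ D) with h | h | h
  · exfalso
    have h1 : v (x ^ (B * r) * z) < v x ^ D := by
      rw [hxz]
      refine lt_of_pow_lt_pow_left₀ (r + 1) zero_le ?_
      rw [mul_pow, ← pow_mul, ← pow_mul]
      calc v x ^ (B * r * (r + 1)) * v z ^ (r + 1) < v x ^ (B * r * (r + 1)) * v x ^ D :=
            mul_lt_mul_of_pos_left h (pow_pos hx0 _)
        _ = v x ^ (B * r * (r + 1) + D) := (pow_add _ _ _).symm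
        _ ≤ v x ^ (D * (r + 1)) := by
            refine pow_le_pow_right₀ hx.le ?_
            nlinarith
    have h2 : v (aeval x g) < v x ^ D := by
      have : aeval x g = z ^ (r + 1) - x ^ (B * r) * z := by rw [hz]; ring
      rw [this]
      exact Valuation.map_sub_lt _ (hzq ▸ h) h1
    exact absurd hvg h2.ne
  · exact h
  · exfalso
    have hzB : v x ^ B < v z := by
      refine lt_of_pow_lt_pow_left₀ (r + 1) zero_le (lt_of_le_of_lt ?_ h)
      rw [← pow_mul]
      exact pow_le_pow_right₀ hx.le (by nlinarith)
    have hz0 : 0 < v z := lt_of_le_of_lt zero_le hzB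
    have h1 : v (x ^ (B * r) * z) < v (z ^ (r + 1)) := by
      rw [hxz, hzq, pow_succ, pow_mul]
      exact mul_lt_mul_of_pos_right (pow_lt_pow_left₀ hzB zero_le hr) hz0
    have h2 : v (z ^ (r + 1)) = v (x ^ (B * r) * z + aeval x g) := by rw [hz]
    have h3 : v (x ^ (B * r) * z + aeval x g) < v (z ^ (r + 1)) :=
      Valuation.map_add_lt _ h1 (by rw [hvg, hzq]; exact h)
    exact h3.ne h2.symm

end Valuation

end TracePowers

namespace TracePowers

open Polynomial

section Stepanov

/-- Exponents `(i, j)` of monomials `X ^ i * Z ^ j` of weight at most `m`. -/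
def weightSet (q D m : ℕ) : Finset (ℕ × ℕ) :=
  (Finset.range (m + 1) ×ˢ Finset.range q).filter fun w => q * w.1 + D * w.2 ≤ m

theorem mem_weightSet {q D m : ℕ} (hq : 0 < q) {w : ℕ × ℕ} :
    w ∈ weightSet q D m ↔ w.2 < q ∧ q * w.1 + D * w.2 ≤ m := by
  simp only [weightSet, Finset.mem_filter, Finset.mem_product, Finset.mem_range]
  refine ⟨fun h => ⟨h.1.2, h.2⟩, fun h => ⟨⟨?_, h.1⟩, h.2⟩⟩
  nlinarith [h.2, Nat.zero_le (D * w.2)]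

theorem card_weightSet_le {q D m : ℕ} (hq : 0 < q) (hcop : q.Coprime D) :
    (weightSet q D m).card ≤ m + 1 := by
  rw [← Finset.card_range (m + 1)]
  refine Finset.card_le_card_of_injOn (fun w => q * w.1 + D * w.2) ?_ ?_
  · intro w hw
    simpa [Nat.lt_succ_iff] using ((mem_weightSet hq).mp hw).2
  · intro w hw w' hw' h
    obtain ⟨h1, h2⟩ := weight_injOn hcop ((mem_weightSet hq).mp hw).1
      ((mem_weightSet hq).mp hw').1 h
    exact Prod.ext h1 h2

theorem le_card_weightSet {q D m : ℕ} (hq : 0 < q) (hcop : q.Coprime D) :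
    m + 1 ≤ (weightSet q D m).card + q * D := by
  have hrep : ∀ n, q * D ≤ n → ∃ w : ℕ × ℕ, w.2 < q ∧ q * w.1 + D * w.2 = n := by
    intro n hn
    obtain ⟨u, hu⟩ : ∃ u, D * u ≡ 1 [MOD q] := by
      rcases Nat.lt_or_ge 1 q with h | h
      · obtain ⟨u, -, hu⟩ := Nat.exists_mul_mod_eq_one_of_coprime hcop.symm h
        exact ⟨u, by simp [Nat.ModEq, hu, Nat.mod_eq_of_lt h]⟩
      · obtain rfl : q = 1 := by omega
        exact ⟨0, Nat.modEq_one⟩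
    have hj : u * n % q < q := Nat.mod_lt _ hq
    have hmod : D * (u * n % q) ≡ n [MOD q] := by
      calc D * (u * n % q) ≡ D * (u * n) [MOD q] := (Nat.mod_modEq _ _).mul_left _
        _ = D * u * n := by ring
        _ ≡ 1 * n [MOD q] := hu.mul_right _
        _ = n := one_mul n
    have hle : D * (u * n % q) ≤ n := by nlinarith
    obtain ⟨i, hi⟩ := (Nat.modEq_iff_dvd' hle).mp hmod
    exact ⟨(i, u * n % q), hj, by simp only; omega⟩
  choose! w hw using hrep
  have h1 : (Finset.Ico (q * D) (m + 1)).card ≤ (weightSet q D m).card := by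
    refine Finset.card_le_card_of_injOn w ?_ ?_
    · intro n hn
      simp only [Finset.coe_Ico, Set.mem_Ico] at hn
      obtain ⟨h2, h3⟩ := hw n hn.1
      exact (mem_weightSet hq).mpr ⟨h2, by omega⟩
    · intro n hn n' hn' h
      simp only [Finset.coe_Ico, Set.mem_Ico] at hn hn'
      rw [← (hw n hn.1).2, ← (hw n' hn'.1).2, h]
  rw [Nat.card_Ico] at h1
  omega

variable {E : Type*} [Field E]

/-- The polynomial with the given coefficients on the monomials of weight at most `m`. -/
noncomputable def weightPoly {q D m : ℕ} (u : weightSet q D m → E) : E[X][X] :=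
  ∑ w, C (C (u w) * X ^ (w : ℕ × ℕ).1) * X ^ (w : ℕ × ℕ).2

theorem weightPoly_sub {q D m : ℕ} (u u' : weightSet q D m → E) :
    weightPoly (u - u') = weightPoly u - weightPoly u' := by
  simp [weightPoly, sub_mul, Finset.sum_sub_distrib]

variable {L Γ : Type*} [Field L] [Algebra E L] [LinearOrderedCommGroupWithZero Γ]
  (v : Valuation L Γ) [v.IsTrivialOn E]

theorem valuation_monomial {q D : ℕ} {x z : L} (hz : v z ^ q = v x ^ D) (w : ℕ × ℕ) :
    v (x ^ w.1 * z ^ w.2) ^ q = v x ^ (q * w.1 + D * w.2) := by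
  rw [map_mul, map_pow, map_pow, mul_pow, ← pow_mul, ← pow_mul, mul_comm w.2, pow_mul (v z), hz,
    ← pow_mul, ← pow_add, mul_comm w.1]

/-- A nonzero weighted polynomial takes a value whose valuation is an admissible weight. -/
theorem exists_valuation_biEval_weightPoly {q D m : ℕ} (hq : 0 < q) (hcop : q.Coprime D) {x z : L}
    (hx : 1 < v x) (hz : v z ^ q = v x ^ D) {u : weightSet q D m → E} (hu : u ≠ 0) :
    ∃ n ≤ m, v (biEval E x z (weightPoly u)) ^ q = v x ^ n := by
  classical
  have hb : biEval E x z (weightPoly u) = ∑ w : weightSet q D m,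
      algebraMap E L (u w) * (x ^ (w : ℕ × ℕ).1 * z ^ (w : ℕ × ℕ).2) := by
    simp [weightPoly, mul_assoc]
  let S : Finset (weightSet q D m) := Finset.univ.filter fun w => u w ≠ 0
  have hb' : biEval E x z (weightPoly u) = ∑ w ∈ S,
      algebraMap E L (u w) * (x ^ (w : ℕ × ℕ).1 * z ^ (w : ℕ × ℕ).2) := by
    rw [hb, Finset.sum_filter_of_ne]
    intro w _ h h0
    simp [h0] at h
  have hterm : ∀ w ∈ S, v (algebraMap E L (u w) * (x ^ (w : ℕ × ℕ).1 * z ^ (w : ℕ × ℕ).2)) ^ q =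
      v x ^ (q * (w : ℕ × ℕ).1 + D * (w : ℕ × ℕ).2) := by
    intro w hw
    rw [map_mul, Valuation.IsTrivialOn.eq_one (v := v) (u w) (Finset.mem_filter.mp hw).2, one_mul,
      valuation_monomial v hz]
  have hSne : S.Nonempty := by
    obtain ⟨w, hw⟩ := Function.ne_iff.mp hu
    exact ⟨w, by simpa [S] using hw⟩
  obtain ⟨w, hw, hmax⟩ := S.exists_max_image
    (fun w => q * (w : ℕ × ℕ).1 + D * (w : ℕ × ℕ).2) hSne
  have hx0 : 0 < v x := zero_lt_one.trans hx
  refine ⟨_, ((mem_weightSet hq).mp w.2).2, ?_⟩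
  rw [← hterm w hw, hb', Valuation.map_sum_eq_of_lt v hw]
  intro w' hw'
  simp only [Finset.mem_sdiff, Finset.mem_singleton] at hw'
  refine lt_of_pow_lt_pow_left₀ q zero_le ?_
  rw [hterm w hw, hterm w' hw'.1]
  refine pow_lt_pow_right₀ hx (lt_of_le_of_ne (hmax w' hw'.1) fun h => hw'.2 ?_)
  obtain ⟨h1, h2⟩ := weight_injOn hcop ((mem_weightSet hq).mp w'.2).1
    ((mem_weightSet hq).mp w.2).1 h
  exact Subtype.ext (Prod.ext h1 h2)

end Stepanov

end TracePowers

namespace TracePowers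

open Polynomial

section Stepanov

theorem valuation_sum_pow_le {L Γ ι : Type*} [Field L] [LinearOrderedCommGroupWithZero Γ]
    (v : Valuation L Γ) {q : ℕ} (hq : q ≠ 0) (s : Finset ι) (f : ι → L) {G : Γ}
    (h : ∀ i ∈ s, v (f i) ^ q ≤ G) : v (∑ i ∈ s, f i) ^ q ≤ G := by
  classical
  rcases s.eq_empty_or_nonempty with rfl | hs
  · simp [hq]
  · obtain ⟨j, hj, hmax⟩ := s.exists_max_image (fun i => v (f i)) hs
    exact (pow_le_pow_left₀ zero_le (Valuation.map_sum_le v hmax) q).trans (h j hj)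

variable {E : Type*} [Field E]

/-- The polynomial `Z ^ q - X ^ (B (q - 1)) Z - g(X)` of a twisted Artin–Schreier curve. -/
noncomputable def curvePoly (q B : ℕ) (g : E[X]) : E[X][X] :=
  X ^ q - (C (X ^ (B * (q - 1))) * X + C g)

theorem monic_curvePoly {q : ℕ} (hq : 2 ≤ q) (B : ℕ) (g : E[X]) : (curvePoly q B g).Monic :=
  monic_X_pow_sub (degree_linear_le.trans_lt (by exact_mod_cast hq))

theorem natDegree_curvePoly {q : ℕ} (hq : 2 ≤ q) (B : ℕ) (g : E[X]) :
    (curvePoly q B g).natDegree = q := by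
  rw [curvePoly, natDegree_sub_eq_left_of_natDegree_lt, natDegree_X_pow]
  rw [natDegree_X_pow]
  exact natDegree_linear_le.trans_lt (by omega)

theorem biEval_curvePoly {L : Type*} [Field L] [Algebra E L] (q B : ℕ) (g : E[X]) (x z : L) :
    biEval E x z (curvePoly q B g) = z ^ q - (x ^ (B * (q - 1)) * z + aeval x g) := by
  simp [curvePoly]

theorem biEval_modByMonic {L : Type*} [Field L] [Algebra E L] {x z : L} (R : E[X][X]) {P : E[X][X]}
    (h : biEval E x z P = 0) :
    biEval E x z (R %ₘ P) = biEval E x z R := by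
  conv_rhs => rw [← modByMonic_add_div R P]
  rw [map_add, map_mul, h, zero_mul, add_zero]

/-- The combination `∑ U_k ^ a * m_k ^ b` over the monomials `m_k` of weight at most `l`. -/
noncomputable def frobeniusCombination {q D l e : ℕ} (a b : ℕ)
    (u : weightSet q D l → weightSet q D e → E) : E[X][X] :=
  ∑ k, weightPoly (u k) ^ a *
    (C (X ^ (k : ℕ × ℕ).1) * X ^ (k : ℕ × ℕ).2 : E[X][X]) ^ b

theorem frobeniusCombination_sub (p : ℕ) [Fact p.Prime] [CharP E p] {q D l e t : ℕ} (b : ℕ)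
    (u u' : weightSet q D l → weightSet q D e → E) :
    frobeniusCombination (p ^ t) b (u - u') =
      frobeniusCombination (p ^ t) b u - frobeniusCombination (p ^ t) b u' := by
  simp only [frobeniusCombination, Pi.sub_apply, weightPoly_sub, ← Finset.sum_sub_distrib,
    ← sub_mul]
  refine Finset.sum_congr rfl fun k _ => ?_
  rw [sub_pow_char_pow]

section Place

variable {L Γ : Type*} [Field L] [Algebra E L] [LinearOrderedCommGroupWithZero Γ]
  (v : Valuation L Γ) [v.IsTrivialOn E] {q D : ℕ} {x z : L}

theorem exists_valuation_frobeniusCombination_term (hq0 : 0 < q) (hcop : q.Coprime D)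
    (hVx : 1 < v x) (hvz : v z ^ q = v x ^ D) {e : ℕ} (a b : ℕ) {u : weightSet q D e → E}
    (hu : u ≠ 0) (k : ℕ × ℕ) :
    ∃ n ≤ e, v (biEval E x z (weightPoly u ^ a * (C (X ^ k.1) * X ^ k.2 : E[X][X]) ^ b)) ^ q =
      v x ^ (n * a + b * (q * k.1 + D * k.2)) := by
  obtain ⟨n, hn, h⟩ := exists_valuation_biEval_weightPoly v hq0 hcop hVx hvz hu
  refine ⟨n, hn, ?_⟩
  have hmon : biEval E x z (C (X ^ k.1) * X ^ k.2 : E[X][X]) = x ^ k.1 * z ^ k.2 := by simp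
  rw [map_mul, map_mul, mul_pow, map_pow, map_pow, pow_right_comm, h, map_pow, map_pow,
    pow_right_comm _ b q, hmon, valuation_monomial v hvz, ← pow_mul, ← pow_mul, ← pow_add,
    mul_comm b]

theorem valuation_frobeniusCombination_le (hq0 : 0 < q) (hcop : q.Coprime D)
    (hVx : 1 < v x) (hvz : v z ^ q = v x ^ D) {l e a : ℕ} (ha : a ≠ 0) (b : ℕ)
    (u : weightSet q D l → weightSet q D e → E) :
    v (biEval E x z (frobeniusCombination a b u)) ^ q ≤ v x ^ (e * a + b * l) := by
  rw [frobeniusCombination, map_sum]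
  refine valuation_sum_pow_le v hq0.ne' _ _ fun k _ => ?_
  by_cases hk : u k = 0
  · rw [hk]
    simp [weightPoly, hq0.ne', ha]
  · obtain ⟨n, hn, h⟩ := exists_valuation_frobeniusCombination_term v hq0 hcop hVx hvz a b hk k
    rw [h]
    exact pow_le_pow_right₀ hVx.le (Nat.add_le_add (Nat.mul_le_mul_right a hn)
      (Nat.mul_le_mul_left b ((mem_weightSet hq0).mp k.2).2))

theorem biEval_frobeniusCombination_ne_zero (hq0 : 0 < q) (hcop : q.Coprime D)
    (hVx : 1 < v x) (hvz : v z ^ q = v x ^ D) {l e s : ℕ} (hes : e < s)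
    {d : weightSet q D l → weightSet q D e → E} (hd0 : d ≠ 0) :
    biEval E x z (frobeniusCombination 1 s d) ≠ 0 := by
  classical
  have hvx0 : 0 < v x := zero_lt_one.trans hVx
  set F : weightSet q D l → L := fun k => biEval E x z
    (weightPoly (d k) ^ 1 * (C (X ^ (k : ℕ × ℕ).1) * X ^ (k : ℕ × ℕ).2 : E[X][X]) ^ s) with hF
  have hterm : ∀ k, d k ≠ 0 → ∃ n ≤ e, v (F k) ^ q =
      v x ^ (n * 1 + s * (q * (k : ℕ × ℕ).1 + D * (k : ℕ × ℕ).2)) := fun k hk =>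
    exists_valuation_frobeniusCombination_term v hq0 hcop hVx hvz 1 s hk k
  choose n hn hterm using hterm
  let S : Finset (weightSet q D l) := Finset.univ.filter fun k => d k ≠ 0
  have hHS : biEval E x z (frobeniusCombination 1 s d) = ∑ k ∈ S, F k := by
    rw [frobeniusCombination, map_sum, Finset.sum_filter_of_ne]
    intro k _ h h0
    simp [hF, h0, weightPoly] at h
  obtain ⟨k, hk⟩ := Function.ne_iff.mp hd0
  have hkS : k ∈ S := by simpa [S] using hk
  have hle := le_valuation_sum v S F ?_ hkS
  · rw [← hHS] at hle
    intro h0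
    rw [h0, map_zero] at hle
    have h1 := hterm k hk
    rw [le_antisymm hle zero_le, zero_pow hq0.ne'] at h1
    exact (pow_pos hvx0 _).ne h1
  · intro k hk k' hk' h
    have hk1 : d k ≠ 0 := (Finset.mem_filter.mp hk).2
    have hk1' : d k' ≠ 0 := (Finset.mem_filter.mp hk').2
    have h1 := congrArg (· ^ q) h
    simp only [hterm k hk1, hterm k' hk1'] at h1
    have h2 := pow_right_injective₀ hvx0 hVx.ne' h1
    have h3 : ∀ a b, a ≤ e → (a * 1 + s * b) / s = b := fun a b ha => by
      rw [Nat.add_mul_div_left _ _ (by omega), Nat.div_eq_of_lt (by omega), zero_add]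
    have h4 := congrArg (· / s) h2
    simp only [h3 _ _ (hn k hk1), h3 _ _ (hn k' hk1')] at h4
    obtain ⟨h5, h6⟩ := weight_injOn hcop ((mem_weightSet hq0).mp k.2).1
      ((mem_weightSet hq0).mp k'.2).1 h4
    exact Subtype.ext (Prod.ext h5 h6)

/-- Siegel's lemma: there is a nontrivial combination vanishing on the curve. -/
theorem exists_frobeniusCombination_modByMonic_eq_zero [Fintype E] (p : ℕ) [Fact p.Prime]
    [CharP E p] (hq0 : 0 < q) (hcop : q.Coprime D) (hVx : 1 < v x) (hvz : v z ^ q = v x ^ D)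
    {Φ : E[X][X]} (hΦ : Φ.Monic) (hΦdeg : Φ.natDegree = q) (hΦ0 : biEval E x z Φ = 0)
    {l e t : ℕ} (hcards : (weightSet q D (e * p ^ t + 1 * l)).card <
      (weightSet q D e).card * (weightSet q D l).card) :
    ∃ d : weightSet q D l → weightSet q D e → E, d ≠ 0 ∧
      frobeniusCombination (p ^ t) 1 d %ₘ Φ = 0 := by
  classical
  have hΦ1 : Φ ≠ 1 := fun h => by rw [h] at hΦdeg; simp at hΦdeg; omega
  have hs0 : p ^ t ≠ 0 := pow_ne_zero _ (Fact.out : p.Prime).ne_zero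
  let f : (weightSet q D l → weightSet q D e → E) → weightSet q D (e * p ^ t + 1 * l) → E :=
    fun u w => ((frobeniusCombination (p ^ t) 1 u %ₘ Φ).coeff (w : ℕ × ℕ).2).coeff (w : ℕ × ℕ).1
  have hcards : Fintype.card (weightSet q D (e * p ^ t + 1 * l) → E) <
      Fintype.card (weightSet q D l → weightSet q D e → E) := by
    simp only [Fintype.card_fun, Fintype.card_coe]
    rw [← pow_mul]
    exact Nat.pow_lt_pow_right Fintype.one_lt_card hcards
  obtain ⟨u, u', huu, hf⟩ := Fintype.exists_ne_map_eq_of_card_lt f hcards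
  refine ⟨u - u', sub_ne_zero.mpr huu, ?_⟩
  by_contra hne
  set R := frobeniusCombination (p ^ t) 1 (u - u') %ₘ Φ with hR
  have hRdeg : R.natDegree < q := hΦdeg ▸ natDegree_modByMonic_lt _ hΦ hΦ1
  obtain ⟨j, hj⟩ : ∃ j, R.coeff j ≠ 0 := by
    by_contra! h
    exact hne (Polynomial.ext (by simpa using h))
  have h1 := le_valuation_biEval v hcop hVx hvz hRdeg hj
  have h2 : v (biEval E x z R) ^ q ≤ v x ^ (e * p ^ t + 1 * l) := by
    rw [hR, biEval_modByMonic _ hΦ0]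
    exact valuation_frobeniusCombination_le v hq0 hcop hVx hvz hs0 1 _
  have h3 := (pow_le_pow_iff_right₀ hVx).mp (h1.trans h2)
  have hjq : j < q := lt_of_le_of_lt (le_natDegree_of_ne_zero hj) hRdeg
  have h4 := congrFun hf ⟨((R.coeff j).natDegree, j), (mem_weightSet hq0).mpr ⟨hjq, h3⟩⟩
  have h5 : R = frobeniusCombination (p ^ t) 1 u %ₘ Φ - frobeniusCombination (p ^ t) 1 u' %ₘ Φ := by
    rw [hR, frobeniusCombination_sub, sub_modByMonic]
  refine hj (leadingCoeff_eq_zero.mp ?_)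
  have h6 : (R.coeff j).coeff (R.coeff j).natDegree = 0 := by
    conv_lhs => arg 1; rw [h5]
    rw [coeff_sub, coeff_sub, sub_eq_zero]
    exact h4
  exact h6

end Place

theorem exists_generic_point {q B D : ℕ} (hq : 2 ≤ q) (hBD : q * B < D) {g : E[X]}
    (hg : g.natDegree = D) :
    ∃ (V : ValuationSubring (AlgebraicClosure (RatFunc E))) (x z : AlgebraicClosure (RatFunc E)),
      V.valuation.IsTrivialOn E ∧ 1 < V.valuation x ∧ V.valuation z ^ q = V.valuation x ^ D ∧
      biEval E x z (curvePoly q B g) = 0 := by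
  let L := AlgebraicClosure (RatFunc E)
  let x : L := algebraMap (RatFunc E) L RatFunc.X
  have hxt : Transcendental E x :=
    (transcendental_algebraMap_iff (algebraMap (RatFunc E) L).injective).mpr
      RatFunc.transcendental_X
  obtain ⟨V, hVE, hVx⟩ := exists_valuation_one_lt hxt
  obtain ⟨z, hz⟩ : ∃ z : L, z ^ q = x ^ (B * (q - 1)) * z + aeval x g := by
    let P : L[X] := X ^ q - (C (x ^ (B * (q - 1))) * X + C (aeval x g))
    have hP : P.degree = q := by
      rw [degree_sub_eq_left_of_degree_lt, degree_X_pow]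
      rw [degree_X_pow]
      exact degree_linear_le.trans_lt (by exact_mod_cast hq)
    obtain ⟨z, hz⟩ := IsAlgClosed.exists_root P (by rw [hP]; exact_mod_cast (by omega : q ≠ 0))
    exact ⟨z, by simpa [P, sub_eq_zero] using hz⟩
  refine ⟨V, x, z, hVE, hVx, valuation_artinSchreier_root _ hq hBD hVx hg hz, ?_⟩
  rw [biEval_curvePoly, hz, sub_self]

/-- **Stepanov's bound** for the curve `z ^ q = x ^ (B (q - 1)) z + g(x)` over a finite field with
`s ^ 2` elements. -/
theorem card_fibers_le [Fintype E] (p : ℕ) [Fact p.Prime] [CharP E p] {t q s : ℕ}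
    (hs : s = p ^ t) (hcard : Fintype.card E = s ^ 2) (hq : 2 ≤ q) {B D : ℕ} (hBD : q * B < D)
    (hcop : q.Coprime D) {g : E[X]} (hg : g.natDegree = D) (hlarge : (q * D + 2) ^ 2 ≤ s)
    (T : Finset E) (hT : ∀ x ∈ T, ∃ Z : Finset E, q ≤ Z.card ∧
      ∀ z ∈ Z, z ^ q = x ^ (B * (q - 1)) * z + g.eval x) :
    q * T.card ≤ s ^ 2 + (2 * (q * D) + 1) * s := by
  have hq0 : 0 < q := by omega
  set G := q * D with hG
  have hs1 : 1 ≤ s := by nlinarith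
  obtain ⟨V, x, z, hVE, hVx, hvz, hΦ0⟩ := exists_generic_point hq hBD hg
  set v := V.valuation with hv
  set Φ := curvePoly q B g with hΦdef
  have hΦ : Φ.Monic := monic_curvePoly hq B g
  have hΦdeg : Φ.natDegree = q := natDegree_curvePoly hq B g
  have hΦ1 : Φ ≠ 1 := fun h => by rw [h] at hΦdeg; simp at hΦdeg; omega
  have hcards : (weightSet q D ((s - 1) * p ^ t + 1 * (s + 2 * G))).card <
      (weightSet q D (s - 1)).card * (weightSet q D (s + 2 * G)).card := by
    rw [← hs]
    have h1 := card_weightSet_le (m := (s - 1) * s + 1 * (s + 2 * G)) hq0 hcop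
    have h2 := le_card_weightSet (m := s - 1) hq0 hcop
    have h3 := le_card_weightSet (m := s + 2 * G) hq0 hcop
    rw [← hG] at h2 h3
    generalize (weightSet q D ((s - 1) * s + 1 * (s + 2 * G))).card = c1 at *
    generalize (weightSet q D (s - 1)).card = c2 at *
    generalize (weightSet q D (s + 2 * G)).card = c3 at *
    clear_value G
    have h5 : s + G + 1 ≤ c3 := by omega
    have hGs : G ≤ s := by nlinarith
    obtain ⟨r, hr⟩ : ∃ r, s = r + G := ⟨s - G, by omega⟩
    have h6 : r ≤ c2 := by omega
    have h7 : r * (s + G + 1) ≤ c2 * c3 := Nat.mul_le_mul h6 h5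
    have h8 : (s - 1) * s + s = s * s := by
      rw [← Nat.succ_mul, Nat.succ_eq_add_one, Nat.sub_add_cancel hs1]
    have h9 : s * s + 2 * G + 1 < r * (s + G + 1) := by
      subst hr
      nlinarith
    omega
  obtain ⟨d, hd0, hδd⟩ :=
    exists_frobeniusCombination_modByMonic_eq_zero v p hq0 hcop hVx hvz hΦ hΦdeg hΦ0 hcards
  rw [← hs] at hδd
  set H : E[X][X] := frobeniusCombination 1 s d with hH
  set R := H %ₘ Φ with hR
  have hRdeg : R.natDegree < q := hΦdeg ▸ natDegree_modByMonic_lt _ hΦ hΦ1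
  have hRH : biEval E x z R = biEval E x z H := biEval_modByMonic _ hΦ0
  have hHne : biEval E x z H ≠ 0 :=
    biEval_frobeniusCombination_ne_zero v hq0 hcop hVx hvz (by omega) hd0
  have hHle : v (biEval E x z H) ^ q ≤ v x ^ ((s - 1) * 1 + s * (s + 2 * G)) :=
    valuation_frobeniusCombination_le v hq0 hcop hVx hvz one_ne_zero s _
  obtain ⟨j, hj⟩ : ∃ j, R.coeff j ≠ 0 := by
    by_contra! h
    refine hHne ?_
    rw [← hRH, show R = 0 from Polynomial.ext (by simpa using h), map_zero]
  have hdeg : q * (R.coeff j).natDegree ≤ (s - 1) * 1 + s * (s + 2 * G) := by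
    have h1 := le_valuation_biEval v hcop hVx hvz hRdeg hj
    rw [hRH] at h1
    have := (pow_le_pow_iff_right₀ hVx).mp (h1.trans hHle)
    omega
  have hvanish : ∀ x₀ ∈ T, (R.coeff j).eval x₀ = 0 := by
    intro x₀ hx₀
    obtain ⟨Z, hZq, hZ⟩ := hT x₀ hx₀
    have hroot : ∀ z₀ ∈ Z, biEval E x₀ z₀ R = 0 := by
      intro z₀ hz₀
      have hΦz : biEval E x₀ z₀ Φ = 0 := by
        rw [hΦdef, biEval_curvePoly, hZ z₀ hz₀, coe_aeval_eq_eval, sub_self]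
      rw [hR, biEval_modByMonic _ hΦz]
      refine eq_zero_of_pow_eq_zero (n := s) ?_
      have hfix : ∀ c : E, c ^ (s * s) = c := fun c => by
        rw [← sq, ← hcard, FiniteField.pow_card]
      have hsum : ∀ F : weightSet q D (s + 2 * G) → E, (∑ k, F k) ^ s = ∑ k, F k ^ s := by
        intro F
        simp only [hs]
        exact sum_pow_char_pow p _ _ F
      have hδ0 : biEval E x₀ z₀ (frobeniusCombination s 1 d) = 0 := by
        rw [← biEval_modByMonic _ hΦz, hδd, map_zero]
      rw [← hδ0, hH, frobeniusCombination, frobeniusCombination, map_sum, map_sum, hsum]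
      refine Finset.sum_congr rfl fun k _ => ?_
      rw [map_mul, map_mul, mul_pow, map_pow _ _ s, ← pow_mul, hfix, pow_one, pow_one,
        map_pow _ (weightPoly (d k)) s]
    have hP0 : R.map (evalRingHom x₀) = 0 := by
      refine eq_zero_of_natDegree_lt_card_of_eval_eq_zero' _ Z (fun z₀ hz₀ => ?_)
        (lt_of_le_of_lt natDegree_map_le (hRdeg.trans_le hZq))
      rw [eval_map, ← hroot z₀ hz₀]
      rfl
    have := congrArg (coeff · j) hP0
    simpa using this
  have hTle : T.card ≤ (R.coeff j).natDegree := by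
    by_contra! hlt
    exact hj (eq_zero_of_natDegree_lt_card_of_eval_eq_zero' _ T hvanish hlt)
  calc q * T.card ≤ q * (R.coeff j).natDegree := Nat.mul_le_mul_left q hTle
    _ ≤ (s - 1) * 1 + s * (s + 2 * G) := hdeg
    _ ≤ s ^ 2 + (2 * G + 1) * s := by
      have : s - 1 ≤ s := by omega
      nlinarith

end Stepanov

end TracePowers

namespace TracePowers

open Polynomial

section LaurentEval

variable {F : Type*} [Field F] {E : Type*} [Field E] [Algebra F E]

/-- The value at `x` of the Laurent polynomial with coefficients `c`. -/
noncomputable def laurentEval (c : ℤ →₀ F) (x : E) : E :=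
  ∑ b ∈ c.support, algebraMap F E (c b) * x ^ b

lemma map_laurentEval {E' : Type*} [Field E'] [Algebra F E'] (φ : E →ₐ[F] E') (c : ℤ →₀ F)
    (x : E) : φ (laurentEval c x) = laurentEval c (φ x) := by
  simp [laurentEval]

/-- The polynomial `X ^ N * (f - e)`, where `f` is the Laurent polynomial with coefficients `c`. -/
noncomputable def laurentPoly (N : ℕ) (c : ℤ →₀ F) (e : E) : E[X] :=
  ∑ b ∈ c.support, C (algebraMap F E (c b)) * X ^ (b + N).toNat - C e * X ^ N

lemma eval_laurentPoly {N : ℕ} {c : ℤ →₀ F} (hN : ∀ b ∈ c.support, -(N : ℤ) ≤ b) (e : E) {x : E}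
    (hx : x ≠ 0) : (laurentPoly N c e).eval x = x ^ N * (laurentEval c x - e) := by
  simp only [laurentPoly, eval_sub, eval_finsetSum, eval_mul, eval_C, eval_pow, eval_X,
    laurentEval, mul_sub, Finset.mul_sum]
  congr 1
  · refine Finset.sum_congr rfl fun b hb => ?_
    have h1 : (((b + N).toNat : ℕ) : ℤ) = b + N := Int.toNat_of_nonneg (by have := hN b hb; omega)
    rw [← zpow_natCast x (b + N).toNat, h1, zpow_add₀ hx, zpow_natCast]
    ring
  · ring

lemma natDegree_laurentPoly {N D : ℕ} {c : ℤ →₀ F} (hN : ∀ b ∈ c.support, -(N : ℤ) ≤ b)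
    (hD : ∀ b ∈ c.support, b ≤ D) (hcD : c D ≠ 0) (hD0 : 0 < D) (e : E) :
    (laurentPoly N c e).natDegree = D + N := by
  have hle : (laurentPoly N c e).natDegree ≤ D + N := by
    refine (natDegree_sub_le_of_le (n := D + N) (m := D + N) ?_ ?_).trans (by simp)
    · refine natDegree_sum_le_of_forall_le _ _ fun b hb => (natDegree_C_mul_X_pow_le _ _).trans ?_
      have := hD b hb
      have := hN b hb
      omega
    · exact (natDegree_C_mul_X_pow_le _ _).trans (by omega)
  refine natDegree_eq_of_le_of_coeff_ne_zero hle ?_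
  have hcoeff : (laurentPoly N c e).coeff (D + N) = algebraMap F E (c D) := by
    simp only [laurentPoly, coeff_sub, finsetSum_coeff, coeff_C_mul, coeff_X_pow]
    rw [if_neg (by omega), mul_zero, sub_zero, Finset.sum_eq_single (D : ℤ)]
    · rw [if_pos (by omega), mul_one]
    · intro b hb hbD
      have := hN b hb
      rw [if_neg (by omega), mul_zero]
    · intro h
      exact absurd (Finsupp.mem_support_iff.mpr hcD) h
  rw [hcoeff]
  simpa using hcD

end LaurentEval

section ExponentialSum

variable {F E : Type*} [Field F] [Fintype F] [Field E] [Fintype E] [Algebra F E]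

/-- Additive Hilbert 90 for finite fields. -/
lemma exists_pow_card_sub_eq_of_trace_eq_zero {w : E} (hw : Algebra.trace F E w = 0) :
    ∃ y : E, y ^ Fintype.card F - y = w := by
  classical
  set φ : E →ₗ[F] E := (FiniteField.frobeniusAlgHom F E).toLinearMap - LinearMap.id with hφ
  have hφy : ∀ y, φ y = y ^ Fintype.card F - y := fun y => by simp [hφ]
  have hker : Module.finrank F (LinearMap.ker φ) ≤ 1 := by
    have hc := Module.card_eq_pow_finrank (K := F) (V := LinearMap.ker φ)
    have hq : 1 < Fintype.card F := Fintype.one_lt_card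
    have hle : Fintype.card (LinearMap.ker φ) ≤ Fintype.card F := by
      have h1 : Fintype.card (LinearMap.ker φ) =
          ((Finset.univ : Finset E).filter fun y => φ y = 0).card := by
        rw [Fintype.card_subtype]
        simp
      rw [h1, ← FiniteField.X_pow_card_sub_X_natDegree_eq E hq]
      refine le_trans (Finset.card_le_card ?_) ((Multiset.toFinset_card_le _).trans
        (card_roots' (X ^ Fintype.card F - X : E[X])))
      intro y hy
      have hne := FiniteField.X_pow_card_sub_X_ne_zero E hq
      simp only [Finset.mem_filter, Finset.mem_univ, true_and, hφy] at hy
      simp [hne, hy]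
    rw [hc] at hle
    by_contra! h
    have := Nat.pow_lt_pow_right hq h
    rw [pow_one] at this
    omega
  have hrange : LinearMap.range φ ≤ LinearMap.ker (Algebra.trace F E) := by
    rintro _ ⟨y, rfl⟩
    have h := Algebra.trace_eq_of_algEquiv
      (FiniteField.frobeniusAlgEquivOfAlgebraic F E) y
    rw [LinearMap.mem_ker, hφ, LinearMap.sub_apply, map_sub, sub_eq_zero]
    exact h
  have h1 := φ.finrank_range_add_finrank_ker
  have h2 := (Algebra.trace F E).finrank_range_add_finrank_ker
  rw [LinearMap.range_eq_top.mpr (Algebra.trace_surjective F E), finrank_top,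
    Module.finrank_self] at h2
  have heq := Submodule.eq_of_le_of_finrank_le hrange (by omega)
  obtain ⟨y, hy⟩ : w ∈ LinearMap.range φ := heq ▸ LinearMap.mem_ker.mpr hw
  exact ⟨y, by rw [← hφy, hy]⟩

variable {p : ℕ} [Fact p.Prime] [CharP F p] {c : ℤ →₀ F} {B D : ℕ}

lemma card_trace_fiber_le {t : ℕ} (hD0 : 0 < D) (hB : ∀ b ∈ c.support, -(B : ℤ) ≤ b)
    (hD : ∀ b ∈ c.support, b ≤ D) (hcD : c D ≠ 0)
    (hpD : ¬ p ∣ D) (hcard : Fintype.card E = (Fintype.card F ^ t) ^ 2)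
    (hlarge : (Fintype.card F * (D + B * Fintype.card F) + 2) ^ 2 ≤ Fintype.card F ^ t) (a : F)
    (T : Finset E) (hT : ∀ x ∈ T, x ≠ 0 ∧ Algebra.trace F E (laurentEval c x) = a) :
    Fintype.card F * T.card ≤ (Fintype.card F ^ t) ^ 2 +
      (2 * (Fintype.card F * (D + B * Fintype.card F)) + 1) * Fintype.card F ^ t := by
  classical
  have hchar : CharP E p := charP_of_injective_algebraMap (algebraMap F E).injective p
  obtain ⟨n, hp, hqn⟩ := FiniteField.card F p
  have hq1 : 1 < Fintype.card F := Fintype.one_lt_card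
  obtain ⟨e, he⟩ := Algebra.trace_surjective F E a
  have hN : ∀ b ∈ c.support, -((B * Fintype.card F : ℕ) : ℤ) ≤ b := fun b hb => by
    refine le_trans ?_ (hB b hb)
    push_cast
    nlinarith
  have hcopD : (Fintype.card F).Coprime D := by
    rw [hqn]
    exact Nat.Coprime.pow_left _ (hp.coprime_iff_not_dvd.mpr hpD)
  refine card_fibers_le p (s := Fintype.card F ^ t) (t := n * t) (by rw [hqn, pow_mul]) hcard
    (B := B) hq1 ?_ ?_ (natDegree_laurentPoly hN hD hcD hD0 e) hlarge T ?_
  · rw [mul_comm]; omega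
  · simpa using hcopD
  · intro x hx
    obtain ⟨hx0, hxa⟩ := hT x hx
    obtain ⟨y, hy⟩ := exists_pow_card_sub_eq_of_trace_eq_zero (F := F)
      (w := laurentEval c x - e) (by rw [map_sub, hxa, he, sub_self])
    refine ⟨Finset.univ.image fun u : F => x ^ B * (y + algebraMap F E u), ?_, ?_⟩
    · rw [Finset.card_image_of_injective, Finset.card_univ]
      intro u v huv
      have := mul_left_cancel₀ (pow_ne_zero B hx0) huv
      exact (algebraMap F E).injective (add_left_cancel this)
    · intro z hz
      obtain ⟨u, -, rfl⟩ := Finset.mem_image.mp hz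
      have hfrob : (y + algebraMap F E u) ^ Fintype.card F =
          y ^ Fintype.card F + algebraMap F E u := by
        have h := map_add (FiniteField.frobeniusAlgHom F E) y (algebraMap F E u)
        rw [AlgHom.commutes] at h
        exact h
      rw [eval_laurentPoly hN e hx0, mul_pow, hfrob, ← hy, ← pow_mul, pow_mul x B]
      obtain ⟨m, hm⟩ : ∃ m, Fintype.card F = m + 1 := ⟨Fintype.card F - 1, by omega⟩
      rw [hm, Nat.add_sub_cancel, ← pow_mul]
      ring

/-- Square-root cancellation, up to a constant, for exponential sums of Laurent polynomials over
large extensions of square cardinality. -/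
theorem norm_sum_addChar_trace_le [DecidableEq E] {t : ℕ} (hD0 : 0 < D)
    (hB : ∀ b ∈ c.support, -(B : ℤ) ≤ b) (hD : ∀ b ∈ c.support, b ≤ D) (hcD : c D ≠ 0)
    (hpD : ¬ p ∣ D) (hcard : Fintype.card E = (Fintype.card F ^ t) ^ 2)
    (hlarge : (Fintype.card F * (D + B * Fintype.card F) + 2) ^ 2 ≤ Fintype.card F ^ t)
    {ψ : AddChar F ℂ} (hψ : ψ ≠ 1) :
    ‖∑ x ∈ Finset.univ.erase (0 : E), ψ (Algebra.trace F E (laurentEval c x))‖ ≤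
      (2 * (Fintype.card F * (D + B * Fintype.card F)) + 2) * (Fintype.card F : ℝ) ^ t := by
  classical
  set q := Fintype.card F with hq
  set N : F → ℕ := fun a =>
    ((Finset.univ.erase (0 : E)).filter fun x => Algebra.trace F E (laurentEval c x) = a).card
    with hN
  have hNle : ∀ a, q * N a ≤ (q ^ t) ^ 2 + (2 * (q * (D + B * q)) + 1) * q ^ t := by
    intro a
    have h := card_trace_fiber_le hD0 hB hD hcD hpD hcard hlarge a
      ((Finset.univ.erase (0 : E)).filter fun x => Algebra.trace F E (laurentEval c x) = a) ?_
    · exact h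
    · intro x hx
      exact ⟨Finset.ne_of_mem_erase (Finset.mem_filter.mp hx).1, (Finset.mem_filter.mp hx).2⟩
  have hNsum : ∑ a, N a = (q ^ t) ^ 2 - 1 := by
    rw [← hcard, ← Finset.card_univ, ← Finset.card_erase_of_mem (Finset.mem_univ (0 : E))]
    exact (Finset.card_eq_sum_card_fiberwise (t := Finset.univ)
      (fun _ _ => Finset.mem_coe.mpr (Finset.mem_univ _))).symm
  have hsum : ∑ x ∈ Finset.univ.erase (0 : E), ψ (Algebra.trace F E (laurentEval c x)) =
      ∑ a, N a * ψ a := by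
    rw [← Finset.sum_fiberwise_of_maps_to (t := Finset.univ)
      (g := fun x => Algebra.trace F E (laurentEval c x)) (fun _ _ => Finset.mem_univ _)]
    refine Finset.sum_congr rfl fun a _ => ?_
    rw [Finset.sum_congr rfl (g := fun _ => ψ a) fun x hx => by rw [(Finset.mem_filter.mp hx).2]]
    simp [hN]
  have hq0 : (0 : ℝ) < q := by exact_mod_cast Fintype.card_pos
  set U : ℝ := ((q : ℝ) ^ t) ^ 2 + (2 * (q * (D + B * q)) + 1) * q ^ t with hU
  have hsum' : (q : ℂ) * ∑ a, N a * ψ a = ∑ a, ((q * N a - U : ℝ) : ℂ) * ψ a := by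
    have h0 : ∑ a, ψ a = 0 := AddChar.sum_eq_zero_of_ne_one hψ
    push_cast
    simp only [sub_mul, Finset.sum_sub_distrib, ← Finset.mul_sum, h0, mul_zero, sub_zero, mul_assoc]
  have hpt : ∀ a, ((q : ℝ) * N a - U) ≤ 0 := fun a => by
    have := hNle a
    rw [hU, sub_nonpos]
    exact_mod_cast this
  have hbound : (q : ℝ) * ‖∑ a, N a * ψ a‖ ≤ ∑ a, (U - q * N a) := by
    have h1 : (q : ℝ) * ‖∑ a, (N a : ℂ) * ψ a‖ = ‖(q : ℂ) * ∑ a, N a * ψ a‖ := by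
      rw [norm_mul, Complex.norm_natCast]
    rw [h1, hsum']
    refine (norm_sum_le _ _).trans (Finset.sum_le_sum fun a _ => ?_)
    rw [norm_mul, AddChar.norm_apply, mul_one, Complex.norm_real, Real.norm_of_nonpos (hpt a)]
    linarith
  rw [hsum]
  have hQ1 : 1 ≤ (q ^ t) ^ 2 := Nat.one_le_pow _ _ (Nat.pow_pos Fintype.card_pos)
  have hcalc : ∑ a, (U - q * N a) = q * (U - ((q : ℝ) ^ t) ^ 2 + 1) := by
    rw [Finset.sum_sub_distrib, ← Finset.mul_sum, ← Nat.cast_sum, hNsum, Finset.sum_const,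
      Finset.card_univ, nsmul_eq_mul]
    push_cast [hQ1]
    ring
  rw [hcalc] at hbound
  have h3 := le_of_mul_le_mul_left hbound hq0
  refine h3.trans ?_
  have : (1 : ℝ) ≤ (q : ℝ) ^ t := one_le_pow₀ (by exact_mod_cast Fintype.card_pos)
  rw [hU]
  linarith

end ExponentialSum

end TracePowers

namespace TracePowers

open Polynomial

section Newton

variable {R : Type*} [CommRing R]

/-- The polynomial `∏ (1 - r X)` over the members `r` of a multiset. -/
noncomputable def revProd (s : Multiset R) : R[X] := (s.map fun r => 1 - C r * X).prod

/-- The sum of the `k`-th powers of the members of a multiset. -/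
def powerSum (s : Multiset R) (k : ℕ) : R := (s.map (· ^ k)).sum

lemma X_mul_derivative_revProd (s : Multiset R) :
    ((X * derivative (revProd s) : R[X]) : PowerSeries R) =
      -((revProd s : PowerSeries R) *
        (PowerSeries.X * PowerSeries.mk fun k => powerSum s (k + 1))) := by
  induction s using Multiset.induction with
  | empty =>
    have h : (PowerSeries.mk fun k => powerSum (0 : Multiset R) (k + 1)) = 0 := by
      ext k
      simp [powerSum]
    rw [h]
    simp [revProd]
  | cons r s ih =>
    have hcons : revProd (r ::ₘ s) = (1 - C r * X) * revProd s := by simp [revProd]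
    have hgeo : (1 - PowerSeries.C r * PowerSeries.X) *
        (PowerSeries.mk fun k => r ^ (k + 1)) = PowerSeries.C r := by
      ext k
      rw [sub_mul, one_mul, mul_assoc, map_sub, PowerSeries.coeff_C_mul]
      cases k with
      | zero => simp
      | succ k => simp [PowerSeries.coeff_succ_X_mul, pow_succ']
    have hsum : (PowerSeries.mk fun k => powerSum (r ::ₘ s) (k + 1)) =
        (PowerSeries.mk fun k => r ^ (k + 1)) + PowerSeries.mk fun k => powerSum s (k + 1) := by
      ext k
      simp [powerSum]
    rw [hcons, hsum, derivative_mul]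
    push_cast at ih ⊢
    simp only [derivative_sub, derivative_one, derivative_C_mul, derivative_X, coe_sub, coe_mul,
      coe_C, coe_one, coe_zero]
    linear_combination (1 - PowerSeries.C r * PowerSeries.X) * ih +
      PowerSeries.X * (revProd s : PowerSeries R) * hgeo

lemma coeff_zero_revProd (s : Multiset R) : (revProd s).coeff 0 = 1 := by
  rw [revProd, coeff_zero_eq_eval_zero, eval_multiset_prod]
  simp

/-- Newton's identities. -/
lemma powerSum_succ (s : Multiset R) (k : ℕ) :
    powerSum s (k + 1) = -(((k + 1 : ℕ) : R) * (revProd s).coeff (k + 1)) -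
      ∑ i ∈ Finset.range k, (revProd s).coeff (i + 1) * powerSum s (k - i) := by
  have h := congrArg (PowerSeries.coeff (k + 1)) (X_mul_derivative_revProd s)
  rw [Polynomial.coeff_coe, coeff_X_mul, coeff_derivative, mul_left_comm, map_neg,
    PowerSeries.coeff_succ_X_mul, PowerSeries.coeff_mul,
    Finset.Nat.sum_antidiagonal_eq_sum_range_succ_mk, Finset.sum_range_succ'] at h
  simp only [Polynomial.coeff_coe, PowerSeries.coeff_mk, coeff_zero_revProd, one_mul,
    Nat.sub_zero] at h
  rw [Finset.sum_congr rfl (g := fun i => (revProd s).coeff (i + 1) * powerSum s (k - i))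
    fun i hi => ?_] at h
  · push_cast
    linear_combination h
  · rw [show k - (i + 1) + 1 = k - i by have := Finset.mem_range.mp hi; omega]

/-- Sequences satisfying Newton's identities are given by power sums. -/
lemma eq_neg_powerSum_of_newton (s : Multiset R) (S : ℕ → R)
    (hS : ∀ k, ((k + 1 : ℕ) : R) * (revProd s).coeff (k + 1) =
      ∑ i ∈ Finset.range (k + 1), (revProd s).coeff i * S (k + 1 - i)) (k : ℕ) :
    S (k + 1) = -powerSum s (k + 1) := by
  induction k using Nat.strong_induction_on with
  | _ k ih =>
    have h := hS k
    rw [Finset.sum_range_succ', coeff_zero_revProd, one_mul, Nat.sub_zero] at h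
    rw [powerSum_succ, h, neg_sub_left, neg_neg, ← add_assoc, ← Finset.sum_add_distrib,
      Finset.sum_eq_zero, zero_add]
    intro i hi
    have := Finset.mem_range.mp hi
    rw [Nat.add_sub_add_right, show k - i = k - i - 1 + 1 by omega, ih (k - i - 1) (by omega)]
    ring

lemma powerSum_congr {s s' : Multiset R} {k : ℕ}
    (h : ∀ i < k, (revProd s).coeff i = (revProd s').coeff i) {j : ℕ} (hj0 : 0 < j) (hj : j < k) :
    powerSum s j = powerSum s' j := by
  induction j using Nat.strong_induction_on with
  | _ j ih =>
    obtain ⟨j, rfl⟩ : ∃ i, j = i + 1 := ⟨j - 1, by omega⟩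
    rw [powerSum_succ, powerSum_succ, h _ hj, Finset.sum_congr rfl fun i hi => ?_]
    have := Finset.mem_range.mp hi
    rw [h _ (by omega), ih (j - i) (by omega) (by omega) (by omega)]

lemma powerSum_sub {s s' : Multiset R} {k : ℕ} (hk : 0 < k)
    (h : ∀ i < k, (revProd s).coeff i = (revProd s').coeff i) :
    powerSum s k - powerSum s' k = -k * ((revProd s).coeff k - (revProd s').coeff k) := by
  obtain ⟨k, rfl⟩ : ∃ i, k = i + 1 := ⟨k - 1, by omega⟩
  rw [powerSum_succ, powerSum_succ, Finset.sum_congr rfl (g := fun i =>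
    (revProd s').coeff (i + 1) * powerSum s' (k - i)) fun i hi => ?_]
  · ring
  · have := Finset.mem_range.mp hi
    rw [h _ (by omega), powerSum_congr h (by omega) (by omega)]

end Newton

section DominantPower

/-- Infinitely many powers of finitely many elements of the circle are simultaneously close
to `1`. -/
lemma exists_large_pow_re {ι : Type*} [Finite ι] (z : ι → Circle) (t₀ : ℕ) :
    ∃ t ≥ t₀, ∀ i, 1 / 2 < ((z i : ℂ) ^ t).re := by
  have h := mapClusterPt_one_atTop_pow z
  have hopen : {w : ι → Circle | ∀ i, 1 / 2 < (w i : ℂ).re} ∈ nhds (1 : ι → Circle) := by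
    refine IsOpen.mem_nhds ?_ (by simp; norm_num)
    simp only [Set.ofPred_forall]
    refine isOpen_iInter_of_finite fun i => isOpen_lt continuous_const ?_
    fun_prop
  have := (h.frequently hopen).forall_exists_of_atTop t₀
  simpa using this

lemma norm_le_of_norm_powerSum_le {s : Multiset ℂ} {A R : ℝ} (hR : 0 < R) {t₀ : ℕ}
    (h : ∀ t ≥ t₀, ‖powerSum s t‖ ≤ A * R ^ t) {a : ℂ} (ha : a ∈ s) : ‖a‖ ≤ R := by
  classical
  by_contra! hlt
  have hgrow := tendsto_pow_atTop_atTop_of_one_lt ((one_lt_div hR).mpr hlt)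
  obtain ⟨t₁, ht₁⟩ := Filter.eventually_atTop.mp (hgrow.eventually_gt_atTop (2 * A))
  obtain ⟨t, ht, hz⟩ := exists_large_pow_re
    (fun w : s.toFinset => Circle.exp (Complex.arg (w : ℂ))) (max t₀ t₁)
  have hre : ∀ w ∈ s, 1 / 2 * ‖w‖ ^ t ≤ (w ^ t).re := by
    intro w hw
    have h1 := (hz ⟨w, by simpa using hw⟩).le
    rw [Circle.coe_exp] at h1
    have h2 : w ^ t = ((‖w‖ ^ t : ℝ) : ℂ) * Complex.exp (Complex.arg w * Complex.I) ^ t := by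
      rw [Complex.ofReal_pow, ← mul_pow, Complex.norm_mul_exp_arg_mul_I]
    rw [h2, Complex.re_ofReal_mul, mul_comm]
    exact mul_le_mul_of_nonneg_left h1 (by positivity)
  have hpow : 1 / 2 * ‖a‖ ^ t ≤ (powerSum s t).re := by
    have h1 : (powerSum s t).re = (s.map fun w => (w ^ t).re).sum := by
      have := map_multiset_sum Complex.reAddGroupHom (s.map (· ^ t))
      simpa [powerSum, Multiset.map_map, Function.comp_def] using this
    rw [h1]
    refine (hre a ha).trans (Multiset.single_le_sum ?_ _ (Multiset.mem_map_of_mem _ ha))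
    intro x hx
    obtain ⟨w, hw, rfl⟩ := Multiset.mem_map.mp hx
    exact le_trans (by positivity) (hre w hw)
  have h3 := (hpow.trans (Complex.re_le_norm _)).trans (h t (le_trans (le_max_left _ _) ht))
  have h4 := ht₁ t (le_trans (le_max_right _ _) ht)
  rw [div_pow, lt_div_iff₀ (by positivity)] at h4
  linarith

end DominantPower

end TracePowers

namespace TracePowers

open Polynomial

section RootSums

variable {F : Type*} [Field F] {K : Type*} [Field K] [Algebra F K]

/-- The sum of a Laurent polynomial over the roots of `h`, with multiplicity. -/
noncomputable def rootSum (c : ℤ →₀ F) (h : F[X]) : K :=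
  ((h.aroots K).map (laurentEval c)).sum

lemma rootSum_mul (c : ℤ →₀ F) {g h : F[X]} (hgh : g * h ≠ 0) :
    (rootSum c (g * h) : K) = rootSum c g + rootSum c h := by
  rw [rootSum, aroots_mul hgh, Multiset.map_add, Multiset.sum_add, rootSum, rootSum]

lemma rootSum_pow (c : ℤ →₀ F) (g : F[X]) (j : ℕ) :
    (rootSum c (g ^ j) : K) = j * rootSum c g := by
  rw [rootSum, aroots_pow, Multiset.map_nsmul, Multiset.sum_nsmul, nsmul_eq_mul, rootSum]

lemma rootSum_eq_sum (c : ℤ →₀ F) (h : F[X]) :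
    (rootSum c h : K) = ∑ b ∈ c.support,
      algebraMap F K (c b) * ((h.aroots K).map fun x => x ^ b).sum := by
  simp only [rootSum, laurentEval, Finset.sum, ← Multiset.sum_map_mul_left]
  rw [Multiset.sum_map_sum_map]
  rfl

lemma reverse_prod_X_sub_C (s : Multiset K) :
    ((s.map fun r => X - C r).prod).reverse = revProd s := by
  induction s using Multiset.induction with
  | empty => simpa [revProd] using reverse_C (1 : K)
  | cons r s ih =>
    have h1 : (X - C r : K[X]).reverse = 1 - C r * X := by
      have h2 : (X : K[X]).reverse = 1 := by
        simpa using (reverse_X_mul (1 : K[X])).trans (reverse_C (1 : K))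
      rw [sub_eq_add_neg, ← C_neg, reverse_add_C, h2]
      simp [sub_eq_add_neg]
    rw [Multiset.map_cons, Multiset.prod_cons, reverse_mul_of_domain, ih, h1]
    simp [revProd]

lemma prod_X_sub_C_eq_mul_revProd (s : Multiset K) (hs : ∀ r ∈ s, r ≠ 0) :
    (s.map fun r => X - C r).prod = C (((s.map fun r => X - C r).prod).coeff 0) *
      revProd (s.map fun r => r⁻¹) := by
  induction s using Multiset.induction with
  | empty => simp [revProd]
  | cons r s ih =>
    have hr : r ≠ 0 := hs r (Multiset.mem_cons_self r s)
    have h1 : (X - C r : K[X]) = C (-r) * (1 - C r⁻¹ * X) := by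
      rw [mul_sub, mul_one, ← mul_assoc, ← C_mul, neg_mul, mul_inv_cancel₀ hr]
      simp
      ring
    rw [Multiset.map_cons, Multiset.prod_cons, mul_coeff_zero, C_mul, Multiset.map_cons, revProd,
      Multiset.map_cons, Multiset.prod_cons, ← revProd]
    nth_rewrite 1 [ih fun x hx => hs x (Multiset.mem_cons_of_mem hx), h1]
    simp only [coeff_sub, coeff_X_zero, coeff_C_zero, zero_sub]
    ring

variable [IsAlgClosed K]

lemma coeff_revProd_aroots {h : F[X]} (hm : h.Monic) {k : ℕ} (hk : k ≤ h.natDegree) :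
    (revProd (h.aroots K)).coeff k = algebraMap F K (h.coeff (h.natDegree - k)) := by
  have hsp : (h.map (algebraMap F K)).Splits := IsAlgClosed.splits _
  rw [← reverse_prod_X_sub_C, aroots, ← hsp.eq_prod_roots_of_monic (hm.map _), coeff_reverse,
    natDegree_map, revAt_le hk, coeff_map]

lemma coeff_revProd_inv_aroots {h : F[X]} (hm : h.Monic) (h0 : h.coeff 0 ≠ 0) (k : ℕ) :
    (revProd ((h.aroots K).map fun r => r⁻¹)).coeff k =
      (algebraMap F K (h.coeff 0))⁻¹ * algebraMap F K (h.coeff k) := by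
  have hsp : (h.map (algebraMap F K)).Splits := IsAlgClosed.splits _
  have hne : algebraMap F K (h.coeff 0) ≠ 0 := by simpa using h0
  have h1 := prod_X_sub_C_eq_mul_revProd (h.aroots K) fun r hr h => by
    rw [h] at hr
    have := (mem_aroots.mp hr).2
    rw [← coeff_zero_eq_aeval_zero'] at this
    exact hne this
  rw [aroots, ← hsp.eq_prod_roots_of_monic (hm.map _), coeff_map] at h1
  have h2 := congrArg (coeff · k) h1
  simp only [coeff_map, coeff_C_mul] at h2
  rw [h2, aroots, inv_mul_cancel_left₀ hne]

omit [IsAlgClosed K] in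
lemma sum_zpow_eq_powerSum (s : Multiset K) (b : ℤ) :
    (s.map fun x => x ^ b).sum =
      if 0 ≤ b then powerSum s b.toNat else powerSum (s.map fun r => r⁻¹) (-b).toNat := by
  split_ifs with hb
  · obtain ⟨n, rfl⟩ := Int.eq_ofNat_of_zero_le hb
    simp [powerSum]
  · obtain ⟨n, hn⟩ := Int.eq_ofNat_of_zero_le (show 0 ≤ -b by omega)
    obtain rfl : b = -n := by omega
    simp [powerSum, Multiset.map_map]

/-- Translating a high coefficient of `h` changes the sum of a Laurent polynomial over the roots
linearly. -/
lemma rootSum_add_monomial {c : ℤ →₀ F} {B D : ℕ} (hD0 : 0 < D)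
    (hB : ∀ b ∈ c.support, -(B : ℤ) ≤ b) (hD : ∀ b ∈ c.support, b ≤ D) (h0c : (0 : ℤ) ∉ c.support)
    {h : F[X]} (hm : h.Monic) (h0 : h.coeff 0 ≠ 0) (hdeg : D + B < h.natDegree) (t : F)
    {h' : F[X]} (hh' : h' = h + C t * X ^ (h.natDegree - D)) (hm' : h'.Monic)
    (hn' : h'.natDegree = h.natDegree) :
    (rootSum c h' : K) = rootSum c h - algebraMap F K (c D * (D * t)) := by
  have hcoeff : ∀ i, h'.coeff i = h.coeff i + if i = h.natDegree - D then t else 0 := by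
    intro i
    rw [hh', coeff_add, coeff_C_mul, coeff_X_pow]
    split_ifs <;> simp
  have h00 : h'.coeff 0 = h.coeff 0 := by rw [hcoeff, if_neg (by omega), add_zero]
  have hrev : ∀ i < D, (revProd (h'.aroots K)).coeff i = (revProd (h.aroots K)).coeff i := by
    intro i hi
    rw [coeff_revProd_aroots hm' (by omega), coeff_revProd_aroots hm (by omega), hcoeff,
      if_neg (by omega), add_zero, hn']
  have hinv : ∀ i < B + 1, (revProd ((h'.aroots K).map fun r => r⁻¹)).coeff i =
      (revProd ((h.aroots K).map fun r => r⁻¹)).coeff i := by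
    intro i hi
    rw [coeff_revProd_inv_aroots hm' (h00 ▸ h0), coeff_revProd_inv_aroots hm h0, h00, hcoeff,
      if_neg (by omega), add_zero]
  have hterm : ∀ b ∈ c.support, algebraMap F K (c b) * ((h'.aroots K).map fun x => x ^ b).sum =
      algebraMap F K (c b) * ((h.aroots K).map fun x => x ^ b).sum -
        if b = D then algebraMap F K (c D * (D * t)) else 0 := by
    intro b hb
    have hbB := hB b hb
    have hbD := hD b hb
    have hb0 : b ≠ 0 := fun h => h0c (h ▸ hb)
    rw [sum_zpow_eq_powerSum, sum_zpow_eq_powerSum]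
    split_ifs with hb1 hb2 hb2
    · subst hb2
      have h1 := powerSum_sub hD0 hrev
      rw [coeff_revProd_aroots hm' (by omega), coeff_revProd_aroots hm (by omega), hcoeff, hn',
        if_pos rfl, map_add, add_sub_cancel_left] at h1
      rw [Int.toNat_natCast, map_mul, map_mul, map_natCast (algebraMap F K)]
      linear_combination algebraMap F K (c D) * h1
    · rw [powerSum_congr hrev (by omega) (by omega), sub_zero]
    · omega
    · rw [powerSum_congr hinv (by omega) (by omega), sub_zero]
  rw [rootSum_eq_sum, rootSum_eq_sum, Finset.sum_congr rfl hterm, Finset.sum_sub_distrib,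
    Finset.sum_ite_eq']
  congr 1
  split_ifs with h
  · rfl
  · simp [Finsupp.notMem_support_iff.mp h]

end RootSums

section CharacterSums

variable {F : Type*} [Field F] [Finite F] {K : Type*} [Field K] [Algebra F K]

lemma finite_monic_natDegree (m : ℕ) :
    {h : F[X] | h.Monic ∧ h.natDegree = m ∧ h.coeff 0 ≠ 0}.Finite := by
  refine (Set.finite_range fun a : Fin (m + 1) → F => ∑ i, C (a i) * X ^ (i : ℕ)).subset ?_
  rintro h ⟨-, hm, -⟩
  refine ⟨fun i => h.coeff i, ?_⟩
  conv_rhs => rw [h.as_sum_range_C_mul_X_pow, hm]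
  exact (Finset.sum_range fun i => C (h.coeff i) * X ^ i).symm

/-- The monic polynomials of degree `m` that do not vanish at `0`. -/
noncomputable def monicSet (F : Type*) [Field F] [Finite F] (m : ℕ) : Finset F[X] :=
  (finite_monic_natDegree (F := F) m).toFinset

lemma mem_monicSet {m : ℕ} {h : F[X]} :
    h ∈ monicSet F m ↔ h.Monic ∧ h.natDegree = m ∧ h.coeff 0 ≠ 0 := by
  simp [monicSet]

/-- The value on `h` of the completely multiplicative function attached to `ψ` and `c`. -/
noncomputable def polyChar (ψ : AddChar F ℂ) (τ : K →ₗ[F] F) (c : ℤ →₀ F) (h : F[X]) : ℂ :=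
  ψ (τ (rootSum c h))

/-- The `m`-th coefficient of the `L`-function attached to `ψ` and `c`. -/
noncomputable def lCoeff (ψ : AddChar F ℂ) (τ : K →ₗ[F] F) (c : ℤ →₀ F) (m : ℕ) : ℂ :=
  ∑ h ∈ monicSet F m, polyChar ψ τ c h

variable {ψ : AddChar F ℂ} {τ : K →ₗ[F] F} {c : ℤ →₀ F}

omit [Finite F] in
lemma polyChar_mul {g h : F[X]} (hgh : g * h ≠ 0) :
    polyChar ψ τ c (g * h) = polyChar ψ τ c g * polyChar ψ τ c h := by
  rw [polyChar, rootSum_mul c hgh, map_add, AddChar.map_add_eq_mul, polyChar, polyChar]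

lemma lCoeff_zero : lCoeff ψ τ c 0 = 1 := by
  have h : monicSet F 0 = {1} := by
    ext h
    rw [mem_monicSet, Finset.mem_singleton]
    constructor
    · rintro ⟨h1, h2, -⟩
      exact (Monic.natDegree_eq_zero h1).mp h2
    · rintro rfl
      simp [monic_one]
  simp [lCoeff, h, polyChar, rootSum]

lemma lCoeff_eq_zero [IsAlgClosed K] {B D : ℕ} (hτ : ∀ a, τ (algebraMap F K a) = a) (hψ : ψ ≠ 1)
    (hD0 : 0 < D)
    (hB : ∀ b ∈ c.support, -(B : ℤ) ≤ b) (hD : ∀ b ∈ c.support, b ≤ D) (h0c : (0 : ℤ) ∉ c.support)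
    (hcD : c D * D ≠ 0) {m : ℕ} (hm : D + B < m) : lCoeff ψ τ c m = 0 := by
  obtain ⟨a, ha⟩ := AddChar.ne_one_iff.mp hψ
  set t : F := -a / (c D * D) with ht
  have hcdt : -(c D * (D * t)) = a := by
    rw [ht, ← mul_assoc, mul_div_cancel₀ _ hcD, neg_neg]
  have hshift : ∀ (u : F) h, h ∈ monicSet F m → h + C u * X ^ (m - D) ∈ monicSet F m := by
    intro u h hh
    obtain ⟨h1, h2, h3⟩ := mem_monicSet.mp hh
    have hlt : (C u * X ^ (m - D)).natDegree < h.natDegree :=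
      lt_of_le_of_lt (natDegree_C_mul_X_pow_le _ _) (by omega)
    have hlt' : (C u * X ^ (m - D)).degree < h.degree := degree_lt_degree hlt
    refine mem_monicSet.mpr ⟨h1.add_of_left hlt', ?_, ?_⟩
    · rw [natDegree_add_eq_left_of_natDegree_lt hlt, h2]
    · rwa [coeff_add, coeff_C_mul, coeff_X_pow, if_neg (by omega), mul_zero, add_zero]
  have key : lCoeff ψ τ c m = ψ a * lCoeff ψ τ c m := by
    rw [lCoeff, Finset.mul_sum]
    symm
    refine Finset.sum_bij' (fun h _ => h + C t * X ^ (m - D)) (fun h _ => h + C (-t) * X ^ (m - D))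
      (hshift t) (hshift (-t)) (fun h _ => by simp) (fun h _ => by simp) fun h hh => ?_
    obtain ⟨h1, h2, h3⟩ := mem_monicSet.mp hh
    obtain ⟨h1', h2', -⟩ := mem_monicSet.mp (hshift t h hh)
    rw [polyChar, polyChar, rootSum_add_monomial hD0 hB hD h0c h1 h3 (by omega) t (by rw [h2]) h1'
      (by rw [h2', h2]), map_sub, hτ, sub_eq_add_neg, hcdt, AddChar.map_add_eq_mul, mul_comm]
  have : (1 - ψ a) * lCoeff ψ τ c m = 0 := by linear_combination key
  exact (mul_eq_zero.mp this).resolve_left (sub_ne_zero.mpr (Ne.symm ha))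

end CharacterSums

end TracePowers

namespace TracePowers

open Polynomial

section FrobeniusOrbits

variable {F : Type*} [Field F] [Fintype F] {K : Type*} [Field K] [Algebra F K]
  [Algebra.IsAlgebraic F K]

local notation "q" => Fintype.card F

omit [Algebra.IsAlgebraic F K] in
lemma frobenius_pow_apply (i : ℕ) (x : K) :
    (FiniteField.frobeniusAlgHom F K ^ i) x = x ^ q ^ i := by
  induction i with
  | zero => simp
  | succ i ih => rw [pow_succ', AlgHom.mul_apply, ih, FiniteField.frobeniusAlgHom_apply, ← pow_mul,
      pow_succ]

omit [Algebra.IsAlgebraic F K] in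
lemma laurentEval_pow (c : ℤ →₀ F) (x : K) (i : ℕ) :
    laurentEval c x ^ q ^ i = laurentEval c (x ^ q ^ i) := by
  rw [← frobenius_pow_apply, map_laurentEval, frobenius_pow_apply]

lemma natDegree_minpoly_dvd_iff {x : K} {r : ℕ} :
    (minpoly F x).natDegree ∣ r ↔ x ^ q ^ r = x := by
  have hx : IsIntegral F x := Algebra.IsIntegral.isIntegral x
  rw [(minpoly.irreducible hx).natDegree_dvd_iff_dvd_X_pow_card_pow_sub_X, minpoly.dvd_iff,
    Nat.card_eq_fintype_card]
  simp [sub_eq_zero]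

lemma aroots_minpoly [IsAlgClosed K] (x : K) :
    (minpoly F x).aroots K =
      (Multiset.range (minpoly F x).natDegree).map fun i => x ^ q ^ i := by
  have hx : IsIntegral F x := Algebra.IsIntegral.isIntegral x
  have hinj : ∀ i j, i < (minpoly F x).natDegree → j < (minpoly F x).natDegree → i < j →
      x ^ q ^ i ≠ x ^ q ^ j := by
    intro i j hi hj hij h
    have h1 : (FiniteField.frobeniusAlgHom F K ^ i) x =
        (FiniteField.frobeniusAlgHom F K ^ i) (x ^ q ^ (j - i)) := by
      rw [frobenius_pow_apply, frobenius_pow_apply, ← pow_mul, ← pow_add, Nat.sub_add_cancel hij.le,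
        h]
    have h2 := natDegree_minpoly_dvd_iff.mpr
      ((FiniteField.frobeniusAlgHom F K ^ i).toRingHom.injective h1).symm
    have := Nat.le_of_dvd (by omega) h2
    omega
  symm
  refine Multiset.eq_of_le_of_card_le ?_ ?_
  · rw [Multiset.le_iff_subset]
    · intro y hy
      obtain ⟨i, -, rfl⟩ := Multiset.mem_map.mp hy
      rw [mem_aroots]
      refine ⟨minpoly.ne_zero hx, ?_⟩
      rw [← frobenius_pow_apply, aeval_algHom_apply, minpoly.aeval, map_zero]
    · refine Multiset.Nodup.map_on ?_ (Multiset.nodup_range _)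
      intro i hi j hj hij
      rw [Multiset.mem_range] at hi hj
      by_contra hne
      rcases lt_or_gt_of_ne hne with h | h
      · exact hinj i j hi hj h hij
      · exact hinj j i hj hi h hij.symm
  · rw [Multiset.card_map, Multiset.card_range]
    refine (card_roots' _).trans ?_
    rw [natDegree_map]

lemma rootSum_minpoly_pow [IsAlgClosed K] (c : ℤ →₀ F) (x : K) (j : ℕ) :
    (rootSum c (minpoly F x ^ j) : K) =
      ∑ i ∈ Finset.range (j * (minpoly F x).natDegree), laurentEval c x ^ q ^ i := by
  rw [rootSum_pow, rootSum, aroots_minpoly, Multiset.map_map]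
  simp only [Function.comp_def, ← laurentEval_pow]
  induction j with
  | zero => simp
  | succ j ih =>
    rw [Nat.succ_mul, Finset.sum_range_add, ← ih]
    push_cast
    rw [add_mul, one_mul]
    congr 1
    refine congrArg Multiset.sum (Multiset.map_congr rfl fun i _ => ?_)
    rw [pow_add, pow_mul, laurentEval_pow c x (j * _),
      natDegree_minpoly_dvd_iff.mp (Dvd.intro_left _ rfl)]

lemma count_aroots_eq_card [IsAlgClosed K] [DecidableEq K] {h : F[X]} (hh : h ≠ 0)
    {m : ℕ} (hm : h.natDegree ≤ m) (x : K) [DecidablePred fun j => minpoly F x ^ j ∣ h] :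
    (h.aroots K).count x = ((Finset.Icc 1 m).filter fun j => minpoly F x ^ j ∣ h).card := by
  have hx : IsIntegral F x := Algebra.IsIntegral.isIntegral x
  have hfin : FiniteMultiplicity (minpoly F x) h :=
    finiteMultiplicity_of_degree_pos_of_monic (minpoly.degree_pos hx) (minpoly.monic hx) hh
  obtain ⟨g, hg, hndvd⟩ := hfin.exists_eq_pow_mul_and_not_dvd
  set k := multiplicity (minpoly F x) h with hk
  have hg0 : g ≠ 0 := by
    rintro rfl
    exact hndvd (dvd_zero _)
  have hcount : (h.aroots K).count x = k := by
    have h1 : ((minpoly F x).aroots K).count x = 1 := by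
      refine Multiset.count_eq_one_of_mem ?_ ?_
      · exact nodup_roots ((PerfectField.separable_of_irreducible (minpoly.irreducible hx)).map)
      · exact mem_aroots.mpr ⟨minpoly.ne_zero hx, minpoly.aeval F x⟩
    have h2 : (g.aroots K).count x = 0 := by
      refine Multiset.count_eq_zero.mpr fun hmem => hndvd ?_
      exact minpoly.dvd F x (mem_aroots.mp hmem).2
    rw [hg, aroots_mul (hg ▸ hh), aroots_pow, Multiset.count_add, Multiset.count_nsmul, h1, h2,
      mul_one, add_zero]
  rw [hcount]
  have hkm : k ≤ m := by
    have h1 := natDegree_le_of_dvd (hg ▸ Dvd.intro _ rfl : minpoly F x ^ k ∣ h) hh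
    rw [natDegree_pow] at h1
    have h2 := minpoly.natDegree_pos hx
    nlinarith
  have : ((Finset.Icc 1 m).filter fun j => minpoly F x ^ j ∣ h) = Finset.Icc 1 k := by
    ext j
    rw [Finset.mem_filter, Finset.mem_Icc, Finset.mem_Icc, hfin.pow_dvd_iff_le_multiplicity, ← hk]
    omega
  rw [this, Nat.card_Icc, Nat.add_sub_cancel]

end FrobeniusOrbits

section EulerProduct

variable {F : Type*} [Field F] [Fintype F] {K : Type*} [Field K] [Algebra F K]
  [Algebra.IsAlgebraic F K] [IsAlgClosed K]

local notation "q" => Fintype.card F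

variable {ψ : AddChar F ℂ} {τ : K →ₗ[F] F} {c : ℤ →₀ F}

/-- The exponential sum over the nonzero elements of the extension of degree `r`. -/
noncomputable def frobSum (ψ : AddChar F ℂ) (τ : K →ₗ[F] F) (c : ℤ →₀ F) (r : ℕ) : ℂ :=
  ∑ x ∈ nthRootsFinset (q ^ r - 1) (1 : K),
    ψ (τ (∑ i ∈ Finset.range r, laurentEval c x ^ q ^ i))

omit [IsAlgClosed K] in
lemma mem_nthRootsFinset_card_pow {r : ℕ} (hr : 0 < r) {x : K} :
    x ∈ nthRootsFinset (q ^ r - 1) (1 : K) ↔ x ≠ 0 ∧ (minpoly F x).natDegree ∣ r := by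
  have hq : 1 < q ^ r := Nat.one_lt_pow hr.ne' Fintype.one_lt_card
  rw [mem_nthRootsFinset (by omega), natDegree_minpoly_dvd_iff]
  obtain ⟨n, hn⟩ : ∃ n, q ^ r = n + 1 := ⟨q ^ r - 1, by omega⟩
  rw [hn, Nat.add_sub_cancel, pow_succ]
  constructor
  · intro h
    refine ⟨?_, by rw [h, one_mul]⟩
    rintro rfl
    rw [zero_pow (by omega)] at h
    exact zero_ne_one h
  · rintro ⟨h0, h⟩
    exact mul_right_cancel₀ h0 (h.trans (one_mul x).symm)

lemma sum_polyChar_dvd {x : K} (hx0 : x ≠ 0) (m j : ℕ)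
    [DecidablePred fun h => minpoly F x ^ j ∣ h] :
    ∑ h ∈ (monicSet F m).filter (fun h => minpoly F x ^ j ∣ h), polyChar ψ τ c h =
      if j * (minpoly F x).natDegree ≤ m then
        ψ (τ (∑ i ∈ Finset.range (j * (minpoly F x).natDegree), laurentEval c x ^ q ^ i)) *
          lCoeff ψ τ c (m - j * (minpoly F x).natDegree) else 0 := by
  have hx : IsIntegral F x := Algebra.IsIntegral.isIntegral x
  have hPm : (minpoly F x ^ j).Monic := (minpoly.monic hx).pow j
  have hPdeg : (minpoly F x ^ j).natDegree = j * (minpoly F x).natDegree := by rw [natDegree_pow]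
  have hP0 : (minpoly F x ^ j).coeff 0 ≠ 0 := by
    rw [coeff_zero_eq_eval_zero, eval_pow, ← coeff_zero_eq_eval_zero]
    exact pow_ne_zero _ (minpoly.coeff_zero_ne_zero hx hx0)
  rw [← hPdeg]
  split_ifs with hle
  · rw [lCoeff, Finset.mul_sum]
    symm
    refine Finset.sum_bij (fun h _ => (minpoly F x ^ j) * h) ?_ ?_ ?_ ?_
    · intro h hh
      obtain ⟨h1, h2, h3⟩ := mem_monicSet.mp hh
      refine Finset.mem_filter.mpr ⟨mem_monicSet.mpr ⟨hPm.mul h1, ?_, ?_⟩, Dvd.intro _ rfl⟩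
      · rw [hPm.natDegree_mul h1, h2]
        omega
      · rw [mul_coeff_zero]
        exact mul_ne_zero hP0 h3
    · intro h _ h' _ heq
      exact mul_left_cancel₀ hPm.ne_zero heq
    · intro h hh
      obtain ⟨hh1, g, rfl⟩ := Finset.mem_filter.mp hh
      obtain ⟨h1, h2, h3⟩ := mem_monicSet.mp hh1
      have hg : g.Monic := hPm.of_mul_monic_left h1
      refine ⟨g, mem_monicSet.mpr ⟨hg, ?_, ?_⟩, rfl⟩
      · rw [hPm.natDegree_mul hg] at h2
        omega
      · rw [mul_coeff_zero] at h3
        exact right_ne_zero_of_mul h3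
    · intro h hh
      obtain ⟨h1, -, -⟩ := mem_monicSet.mp hh
      rw [polyChar_mul (mul_ne_zero hPm.ne_zero h1.ne_zero), hPdeg, ← rootSum_minpoly_pow, polyChar,
        polyChar]
  · refine Finset.sum_eq_zero fun h hh => absurd ?_ hle
    obtain ⟨hh1, hdvd⟩ := Finset.mem_filter.mp hh
    obtain ⟨h1, h2, -⟩ := mem_monicSet.mp hh1
    exact h2 ▸ natDegree_le_of_dvd hdvd h1.ne_zero

/-- The logarithmic derivative of the Euler product of the `L`-function. -/
theorem mul_lCoeff (m : ℕ) :
    (m : ℂ) * lCoeff ψ τ c m = ∑ r ∈ Finset.Icc 1 m, frobSum ψ τ c r * lCoeff ψ τ c (m - r) := by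
  classical
  set Z : Finset K := (Finset.Icc 1 m).biUnion fun r => nthRootsFinset (q ^ r - 1) (1 : K) with hZ
  have hZ0 : ∀ x ∈ Z, x ≠ 0 := by
    intro x hx
    obtain ⟨r, hr, hxr⟩ := Finset.mem_biUnion.mp hx
    exact ((mem_nthRootsFinset_card_pow (Finset.mem_Icc.mp hr).1).mp hxr).1
  have hfilter : ∀ r ∈ Finset.Icc 1 m, nthRootsFinset (q ^ r - 1) (1 : K) =
      Z.filter fun x => (minpoly F x).natDegree ∣ r := by
    intro r hr
    have hr1 := (Finset.mem_Icc.mp hr).1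
    ext x
    rw [Finset.mem_filter]
    constructor
    · exact fun h => ⟨Finset.mem_biUnion.mpr ⟨r, hr, h⟩, ((mem_nthRootsFinset_card_pow hr1).mp h).2⟩
    · exact fun h => (mem_nthRootsFinset_card_pow hr1).mpr ⟨hZ0 x h.1, h.2⟩
  have hcard : ∀ h ∈ monicSet F m, (m : ℂ) * polyChar ψ τ c h =
      ∑ x ∈ Z, ∑ j ∈ Finset.Icc 1 m, if minpoly F x ^ j ∣ h then polyChar ψ τ c h else 0 := by
    intro h hh
    obtain ⟨h1, h2, h3⟩ := mem_monicSet.mp hh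
    have hsub : ∀ x ∈ h.aroots K, x ∈ Z := by
      intro x hx
      obtain ⟨-, hx2⟩ := mem_aroots.mp hx
      have hxi : IsIntegral F x := Algebra.IsIntegral.isIntegral x
      have hle : (minpoly F x).natDegree ≤ m :=
        h2 ▸ natDegree_le_of_dvd (minpoly.dvd F x hx2) h1.ne_zero
      have hpos := minpoly.natDegree_pos hxi
      refine Finset.mem_biUnion.mpr ⟨_, Finset.mem_Icc.mpr ⟨hpos, hle⟩,
        (mem_nthRootsFinset_card_pow hpos).mpr ⟨?_, dvd_rfl⟩⟩
      rintro rfl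
      rw [← coeff_zero_eq_aeval_zero'] at hx2
      exact h3 (by simpa using hx2)
    have hcardroots : (h.aroots K).card = m := by
      have hsp : (h.map (algebraMap F K)).Splits := IsAlgClosed.splits _
      rw [aroots, ← hsp.natDegree_eq_card_roots, natDegree_map, h2]
    have hm := hcardroots
    rw [← Multiset.sum_count_eq_card hsub] at hm
    conv_lhs => rw [← hm, Nat.cast_sum, Finset.sum_mul]
    refine Finset.sum_congr rfl fun x _ => ?_
    rw [count_aroots_eq_card h1.ne_zero h2.le, ← Finset.sum_filter, Finset.sum_const, nsmul_eq_mul]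
  have hreindex : ∀ x ∈ Z, ∑ j ∈ Finset.Icc 1 m, (if j * (minpoly F x).natDegree ≤ m then
        ψ (τ (∑ i ∈ Finset.range (j * (minpoly F x).natDegree), laurentEval c x ^ q ^ i)) *
          lCoeff ψ τ c (m - j * (minpoly F x).natDegree) else 0) =
      ∑ r ∈ Finset.Icc 1 m, if (minpoly F x).natDegree ∣ r then
        ψ (τ (∑ i ∈ Finset.range r, laurentEval c x ^ q ^ i)) * lCoeff ψ τ c (m - r) else 0 := by
    intro x _
    have hxi : IsIntegral F x := Algebra.IsIntegral.isIntegral x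
    have hpos := minpoly.natDegree_pos hxi
    rw [← Finset.sum_filter, ← Finset.sum_filter]
    refine Finset.sum_nbij (fun j => j * (minpoly F x).natDegree) ?_ ?_ ?_ fun _ _ => rfl
    · intro j hj
      obtain ⟨hj1, hj2⟩ := Finset.mem_filter.mp hj
      have := (Finset.mem_Icc.mp hj1).1
      exact Finset.mem_filter.mpr ⟨Finset.mem_Icc.mpr ⟨Nat.mul_pos (by omega) hpos, hj2⟩,
        Dvd.intro_left _ rfl⟩
    · intro i _ j _ hij
      exact Nat.eq_of_mul_eq_mul_right hpos hij
    · intro r hr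
      obtain ⟨hr1, j, rfl⟩ := Finset.mem_filter.mp (Finset.mem_coe.mp hr)
      obtain ⟨hr2, hr3⟩ := Finset.mem_Icc.mp hr1
      refine ⟨j, Finset.mem_coe.mpr (Finset.mem_filter.mpr ⟨Finset.mem_Icc.mpr ⟨?_, ?_⟩, ?_⟩), ?_⟩
      · exact Nat.pos_of_mul_pos_left hr2
      · nlinarith
      · rwa [mul_comm]
      · exact mul_comm _ _
  calc (m : ℂ) * lCoeff ψ τ c m
      = ∑ h ∈ monicSet F m, ∑ x ∈ Z, ∑ j ∈ Finset.Icc 1 m,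
          if minpoly F x ^ j ∣ h then polyChar ψ τ c h else 0 := by
        rw [lCoeff, Finset.mul_sum]
        exact Finset.sum_congr rfl hcard
    _ = ∑ x ∈ Z, ∑ j ∈ Finset.Icc 1 m, ∑ h ∈ monicSet F m,
          if minpoly F x ^ j ∣ h then polyChar ψ τ c h else 0 := by
        rw [Finset.sum_comm]
        exact Finset.sum_congr rfl fun x _ => Finset.sum_comm
    _ = ∑ x ∈ Z, ∑ r ∈ Finset.Icc 1 m, if (minpoly F x).natDegree ∣ r then
          ψ (τ (∑ i ∈ Finset.range r, laurentEval c x ^ q ^ i)) * lCoeff ψ τ c (m - r) else 0 := by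
        refine Finset.sum_congr rfl fun x hx => ?_
        rw [← hreindex x hx]
        refine Finset.sum_congr rfl fun j _ => ?_
        rw [← Finset.sum_filter, sum_polyChar_dvd (hZ0 x hx)]
    _ = _ := by
        rw [Finset.sum_comm]
        refine Finset.sum_congr rfl fun r hr => ?_
        rw [← Finset.sum_filter, ← hfilter r hr, frobSum, Finset.sum_mul]

end EulerProduct

end TracePowers

namespace TracePowers

open Polynomial

section RiemannHypothesis

variable {F : Type*} [Field F] [Fintype F] {K : Type*} [Field K] [Algebra F K]
  [Algebra.IsAlgebraic F K]

local notation "q" => Fintype.card F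

variable {ψ : AddChar F ℂ} {τ : K →ₗ[F] F} {c : ℤ →₀ F}

lemma frobSum_finrank {E : Type*} [Field E] [Algebra F E] [Fintype E] [DecidableEq E]
    (hτ : ∀ a, τ (algebraMap F K a) = a) (ι : E →ₐ[F] K) :
    frobSum ψ τ c (Module.finrank F E) =
      ∑ x ∈ Finset.univ.erase (0 : E), ψ (Algebra.trace F E (laurentEval c x)) := by
  classical
  have : Module.Finite F E := Module.Finite.of_finite
  have hr : 0 < Module.finrank F E := Module.finrank_pos
  have hcard : Fintype.card E = q ^ Module.finrank F E := Module.card_eq_pow_finrank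
  have hset : nthRootsFinset (q ^ Module.finrank F E - 1) (1 : K) =
      (Finset.univ.erase (0 : E)).map ⟨ι, ι.injective⟩ := by
    symm
    refine Finset.eq_of_subset_of_card_le ?_ ?_
    · intro y hy
      obtain ⟨x, hx, rfl⟩ := Finset.mem_map.mp hy
      have hx0 : x ≠ 0 := Finset.ne_of_mem_erase hx
      rw [mem_nthRootsFinset_card_pow hr, natDegree_minpoly_dvd_iff]
      refine ⟨?_, ?_⟩
      · simpa using hx0
      · change ι x ^ _ = ι x
        rw [← map_pow, ← hcard, FiniteField.pow_card]
    · rw [Finset.card_map, Finset.card_erase_of_mem (Finset.mem_univ _), Finset.card_univ, hcard]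
      rw [nthRootsFinset_def]
      exact (Multiset.toFinset_card_le _).trans (card_nthRoots _ _)
  rw [frobSum, hset, Finset.sum_map]
  refine Finset.sum_congr rfl fun x _ => ?_
  have hx (i : ℕ) : laurentEval c (ι x) ^ q ^ i = ι (laurentEval c x ^ q ^ i) := by
    rw [map_pow, map_laurentEval]
  rw [← hτ (Algebra.trace F E (laurentEval c x)), ← ι.commutes,
    FiniteField.algebraMap_trace_eq_sum_pow, Nat.card_eq_fintype_card, map_sum ι]
  simp only [Function.Embedding.coeFn_mk, hx]

variable [IsAlgClosed K]

/-- The `L`-function is a polynomial whose reciprocal roots have modulus at most `√q`. -/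
theorem exists_multiset_lCoeff {p : ℕ} [Fact p.Prime] [CharP F p] {B D : ℕ}
    (hτ : ∀ a, τ (algebraMap F K a) = a) (hψ : ψ ≠ 1) (hD0 : 0 < D)
    (hB : ∀ b ∈ c.support, -(B : ℤ) ≤ b) (hD : ∀ b ∈ c.support, b ≤ D) (h0c : (0 : ℤ) ∉ c.support)
    (hcD : c D ≠ 0) (hpD : ¬ p ∣ D) :
    ∃ α : Multiset ℂ, α.card = D + B ∧ (∀ a ∈ α, ‖a‖ ^ 2 ≤ q) ∧
      ∀ m, lCoeff ψ τ c m = (revProd α).coeff m := by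
  classical
  set N := D + B with hN
  set Λ : ℂ[X] := ∑ i ∈ Finset.range (N + 1), C (lCoeff ψ τ c (N - i)) * X ^ i with hΛ
  have hcoeff : ∀ i, Λ.coeff i = if i ≤ N then lCoeff ψ τ c (N - i) else 0 := by
    intro i
    simp only [hΛ, finsetSum_coeff, coeff_C_mul, coeff_X_pow, mul_ite, mul_one, mul_zero,
      Finset.sum_ite_eq, Finset.mem_range, Nat.lt_succ_iff]
  have hcoeffN : Λ.coeff N = 1 := by rw [hcoeff, if_pos le_rfl, Nat.sub_self, lCoeff_zero]
  have hdegle : Λ.natDegree ≤ N := by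
    rw [natDegree_le_iff_coeff_eq_zero]
    intro i hi
    rw [hcoeff, if_neg (by omega)]
  have hdeg : Λ.natDegree = N := natDegree_eq_of_le_of_coeff_ne_zero hdegle (by simp [hcoeffN])
  have hmonic : Λ.Monic := by rw [Monic, leadingCoeff, hdeg, hcoeffN]
  have hsp : Λ.Splits := IsAlgClosed.splits _
  have hL : ∀ m, lCoeff ψ τ c m = (revProd Λ.roots).coeff m := by
    intro m
    rw [← reverse_prod_X_sub_C, ← hsp.eq_prod_roots_of_monic hmonic, coeff_reverse, hdeg]
    by_cases hm : m ≤ N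
    · rw [revAt_le hm, hcoeff, if_pos (Nat.sub_le _ _), Nat.sub_sub_self hm]
    · rw [revAt_eq_self_of_lt (by omega), hcoeff, if_neg hm]
      have hcD' : c D * (D : F) ≠ 0 := mul_ne_zero hcD fun h =>
        hpD ((CharP.cast_eq_zero_iff F p D).mp h)
      exact lCoeff_eq_zero hτ hψ hD0 hB hD h0c hcD' (by omega)
  have hS : ∀ k, frobSum ψ τ c (k + 1) = -powerSum Λ.roots (k + 1) := by
    refine eq_neg_powerSum_of_newton Λ.roots _ fun k => ?_
    rw [← hL, mul_lCoeff]
    refine Finset.sum_bij' (fun r _ => k + 1 - r) (fun i _ => k + 1 - i) ?_ ?_ ?_ ?_ ?_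
    · intro r hr
      have := Finset.mem_Icc.mp hr
      exact Finset.mem_range.mpr (by omega)
    · intro i hi
      have := Finset.mem_range.mp hi
      exact Finset.mem_Icc.mpr (by omega)
    · intro r hr
      have := Finset.mem_Icc.mp hr
      omega
    · intro i hi
      have := Finset.mem_range.mp hi
      omega
    · intro r hr
      have := Finset.mem_Icc.mp hr
      rw [Nat.sub_sub_self this.2, hL, mul_comm]
  refine ⟨Λ.roots, by rw [← hsp.natDegree_eq_card_roots, hdeg], fun a ha => ?_, hL⟩
  have hq1 : 1 < q := Fintype.one_lt_card
  have hbound : ∀ t ≥ (q * (D + B * q) + 2) ^ 2,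
      ‖powerSum (Λ.roots.map (· ^ 2)) t‖ ≤ (2 * (q * (D + B * q)) + 2) * (q : ℝ) ^ t := by
    intro t ht
    have ht0 : 0 < t := lt_of_lt_of_le (by positivity) ht
    have : NeZero (2 * t) := ⟨by omega⟩
    let E := FiniteField.Extension F p (2 * t)
    let _ : Fintype E := Fintype.ofFinite E
    have hfin : Module.finrank F E = 2 * t := FiniteField.finrank_extension F p (2 * t)
    have hcard : Fintype.card E = (q ^ t) ^ 2 := by
      rw [← Nat.card_eq_fintype_card, FiniteField.natCard_extension, Nat.card_eq_fintype_card,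
        ← pow_mul, mul_comm]
    have h1 := norm_sum_addChar_trace_le (E := E) hD0 hB hD hcD hpD hcard
      (ht.le.trans (Nat.lt_pow_self hq1).le) hψ
    rw [← frobSum_finrank hτ (IsAlgClosed.lift : E →ₐ[F] K), hfin,
      show 2 * t = 2 * t - 1 + 1 by omega, hS, norm_neg] at h1
    have h2 : powerSum (Λ.roots.map (· ^ 2)) t = powerSum Λ.roots (2 * t - 1 + 1) := by
      rw [show 2 * t - 1 + 1 = 2 * t by omega, powerSum, Multiset.map_map, powerSum]
      simp only [Function.comp_def, pow_mul]
    rwa [h2]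
  have := norm_le_of_norm_powerSum_le (by exact_mod_cast Fintype.card_pos) hbound
    (Multiset.mem_map_of_mem _ ha)
  rwa [norm_pow] at this

end RiemannHypothesis

end TracePowers

namespace TracePowers

open Polynomial Matrix

section Companion

variable {R : Type*} [CommRing R] {m : ℕ}

/-- The companion matrix with last column `-a`. -/
def companion (a : Fin (m + 1) → R) : Matrix (Fin (m + 1)) (Fin (m + 1)) R :=
  Matrix.of fun i => Fin.snoc (α := fun _ => R) (fun j => if i = j.succ then 1 else 0) (-a i)

lemma companion_apply_last (a : Fin (m + 1) → R) (i : Fin (m + 1)) :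
    companion a i (Fin.last m) = -a i := by
  simp [companion]

lemma companion_apply_castSucc (a : Fin (m + 1) → R) (i : Fin (m + 1)) (j : Fin m) :
    companion a i j.castSucc = if i = j.succ then 1 else 0 := by
  simp [companion]

lemma companion_pow_mulVec (a : Fin (m + 1) → R) (i : Fin (m + 1)) :
    (companion a ^ (i : ℕ)) *ᵥ Pi.single 0 1 = Pi.single i 1 := by
  induction i using Fin.induction with
  | zero => rw [Fin.val_zero, pow_zero, one_mulVec]
  | succ i ih =>
    rw [Fin.val_succ, pow_succ', ← mulVec_mulVec, ← Fin.val_castSucc i, ih]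
    ext j
    rw [mulVec_single_one, col_apply, companion_apply_castSucc, Pi.single_apply]

lemma coeff_charpoly_companion [Nontrivial R] (a : Fin (m + 1) → R) (i : Fin (m + 1)) :
    (companion a).charpoly.coeff i = a i := by
  have hdeg : (companion a).charpoly.natDegree = m + 1 := by simp
  have hlead : (companion a).charpoly.coeff (m + 1) = 1 := by
    have := (charpoly_monic (companion a)).coeff_natDegree
    rwa [hdeg] at this
  have h := congrArg (· *ᵥ (Pi.single 0 1 : Fin (m + 1) → R)) (aeval_self_charpoly (companion a))
  simp only [aeval_eq_sum_range, hdeg, sum_mulVec, smul_mulVec, zero_mulVec] at h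
  rw [Finset.sum_range_succ, Finset.sum_range, hlead, one_smul, pow_succ', ← mulVec_mulVec] at h
  have hl := companion_pow_mulVec a (Fin.last m)
  rw [Fin.val_last] at hl
  simp only [companion_pow_mulVec, hl] at h
  have := congrFun h i
  simp only [Pi.add_apply, Finset.sum_apply, Pi.smul_apply, Pi.single_apply, smul_eq_mul, mul_ite,
    mul_one, mul_zero, Finset.sum_ite_eq, Finset.mem_univ, if_true, mulVec_single_one, col_apply,
    companion_apply_last, Pi.zero_apply] at this
  linear_combination this

end Companion

section Stabilizer

variable {F : Type*} [Field F] [Fintype F]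

variable (F) in
/-- Matrices of size `m + k` fixing the first `m` basis vectors. -/
lemma card_fixing (m k : ℕ) :
    Nat.card {g : GL (Fin m ⊕ Fin k) F // ∀ i,
        (g : Matrix (Fin m ⊕ Fin k) (Fin m ⊕ Fin k) F).col (Sum.inl i) = Pi.single (Sum.inl i) 1} =
      Fintype.card F ^ (m * k) * Nat.card (GL (Fin k) F) := by
  classical
  let T (x : Matrix (Fin m) (Fin k) F × GL (Fin k) F) : GL (Fin m ⊕ Fin k) F :=
    (isUnit_fromBlocks_zero₂₁.mpr ⟨isUnit_one, x.2.isUnit⟩ :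
      IsUnit (fromBlocks 1 x.1 0 (x.2 : Matrix (Fin k) (Fin k) F))).unit
  have hT (x) : (T x : Matrix (Fin m ⊕ Fin k) (Fin m ⊕ Fin k) F) = fromBlocks 1 x.1 0 x.2 := rfl
  have hfix (x) (i : Fin m) : (T x : Matrix (Fin m ⊕ Fin k) (Fin m ⊕ Fin k) F).col (Sum.inl i) =
      Pi.single (Sum.inl i) 1 := by
    ext (j | j) <;> simp [hT, one_apply, Pi.single_apply]
  have hbij : Function.Bijective (fun x => (⟨T x, hfix x⟩ : {g : GL (Fin m ⊕ Fin k) F //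
      ∀ i, (g : Matrix (Fin m ⊕ Fin k) (Fin m ⊕ Fin k) F).col (Sum.inl i) =
        Pi.single (Sum.inl i) 1})) := by
    refine ⟨fun x y hxy => ?_, fun ⟨g, hg⟩ => ?_⟩
    · have h1 := congrArg (fun g => (g.1 : Matrix (Fin m ⊕ Fin k) (Fin m ⊕ Fin k) F)) hxy
      simp only [hT, fromBlocks_inj] at h1
      exact Prod.ext h1.2.1 (Units.ext h1.2.2.2)
    · set G : Matrix (Fin m ⊕ Fin k) (Fin m ⊕ Fin k) F := g.1 with hG
      have h11 : G.toBlocks₁₁ = 1 := by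
        ext i j
        have := congrFun (hg j) (Sum.inl i)
        simpa [one_apply, Pi.single_apply, toBlocks₁₁] using this
      have h21 : G.toBlocks₂₁ = 0 := by
        ext i j
        have := congrFun (hg j) (Sum.inr i)
        simpa [toBlocks₂₁] using this
      have hfb : G = fromBlocks 1 G.toBlocks₁₂ 0 G.toBlocks₂₂ := by
        rw [← h11, ← h21, fromBlocks_toBlocks]
      have hu : IsUnit (fromBlocks (1 : Matrix (Fin m) (Fin m) F) G.toBlocks₁₂ 0 G.toBlocks₂₂) := by
        rw [← hfb]
        exact g.isUnit
      refine ⟨(G.toBlocks₁₂, (isUnit_fromBlocks_zero₂₁.mp hu).2.unit), ?_⟩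
      refine Subtype.ext (Units.ext ?_)
      rw [hT, IsUnit.unit_spec, ← hG]
      exact hfb.symm
  rw [← Nat.card_eq_of_bijective _ hbij, Nat.card_prod,
    Nat.card_eq_fintype_card (α := Matrix _ _ F)]
  congr 1
  rw [pow_mul', ← Nat.card_eq_fintype_card]
  simp [Matrix]

omit [Fintype F] in
/-- Every linearly independent family is the family of first columns of an invertible matrix. -/
lemma exists_col_eq {m k : ℕ} {u : Fin m → Fin m ⊕ Fin k → F} (hu : LinearIndependent F u) :
    ∃ g : GL (Fin m ⊕ Fin k) F, ∀ i,
      (g : Matrix (Fin m ⊕ Fin k) (Fin m ⊕ Fin k) F).col (Sum.inl i) = u i := by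
  let b := Module.Basis.sumExtend hu
  have hfin : Finite (Fin m ⊕ Module.Basis.sumExtendIndex hu) := Module.Finite.finite_basis b
  have hfin' : Finite (Module.Basis.sumExtendIndex hu) :=
    Finite.of_injective _ Sum.inr_injective (β := Fin m ⊕ Module.Basis.sumExtendIndex hu)
  have : Fintype (Module.Basis.sumExtendIndex hu) := Fintype.ofFinite _
  have hc := Module.finrank_eq_card_basis b
  rw [Module.finrank_fintype_fun_eq_card, Fintype.card_sum, Fintype.card_sum] at hc
  have e : Module.Basis.sumExtendIndex hu ≃ Fin k := Fintype.equivOfCardEq (by omega)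
  let b' := b.reindex (Equiv.sumCongr (Equiv.refl _) e)
  let g := (Pi.basisFun F (Fin m ⊕ Fin k)).toMatrix b'
  have hg : IsUnit g := by
    have := (Pi.basisFun F (Fin m ⊕ Fin k)).invertibleToMatrix b'
    exact isUnit_of_invertible _
  refine ⟨hg.unit, fun i => ?_⟩
  ext j
  simp [g, b', b, Module.Basis.toMatrix_apply, Module.Basis.sumExtend, Equiv.ofInjective]
  rfl

lemma card_col_eq {m k : ℕ} {u : Fin m → Fin m ⊕ Fin k → F} (hu : LinearIndependent F u) :
    Nat.card {g : GL (Fin m ⊕ Fin k) F // ∀ i,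
        (g : Matrix (Fin m ⊕ Fin k) (Fin m ⊕ Fin k) F).col (Sum.inl i) = u i} =
      Fintype.card F ^ (m * k) * Nat.card (GL (Fin k) F) := by
  obtain ⟨h, hh⟩ := exists_col_eq hu
  rw [← card_fixing]
  refine Nat.card_congr ((Equiv.mulLeft h).subtypeEquiv fun g => ?_).symm
  have h1 (g : GL (Fin m ⊕ Fin k) F) (j) : ((h * g : GL (Fin m ⊕ Fin k) F) :
      Matrix (Fin m ⊕ Fin k) (Fin m ⊕ Fin k) F).col j =
      (h : Matrix _ _ F) *ᵥ (g : Matrix (Fin m ⊕ Fin k) (Fin m ⊕ Fin k) F).col j := rfl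
  simp only [Equiv.coe_mulLeft, h1]
  refine forall_congr' fun i => ?_
  rw [← hh i, ← mulVec_single_one (h : Matrix (Fin m ⊕ Fin k) (Fin m ⊕ Fin k) F)]
  refine ⟨fun h => by rw [h], fun h2 => ?_⟩
  exact mulVec_injective_of_isUnit h.isUnit h2

end Stabilizer

end TracePowers

namespace TracePowers

open Polynomial Matrix

section Krylov

variable {F : Type*} [Field F] {ι : Type*} [Fintype ι] [DecidableEq ι]

/-- The family `v, M v, …, M ^ (m - 1) v`. -/
def krylov (M : Matrix ι ι F) (v : ι → F) (m : ℕ) (i : Fin m) : ι → F := (M ^ (i : ℕ)) *ᵥ v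

/-- The vector `v` generates an `M`-stable subspace of dimension `m`. -/
def HasCyclicDim (M : Matrix ι ι F) (v : ι → F) (m : ℕ) : Prop :=
  LinearIndependent F (krylov M v m) ∧ ¬ LinearIndependent F (krylov M v (m + 1))

lemma linearIndependent_krylov_succ_iff {M : Matrix ι ι F} {v : ι → F} {m : ℕ} :
    LinearIndependent F (krylov M v (m + 1)) ↔ LinearIndependent F (krylov M v m) ∧
      (M ^ m) *ᵥ v ∉ Submodule.span F (Set.range (krylov M v m)) := by
  rw [linearIndependent_finSucc']
  rfl

lemma linearIndependent_krylov_of_le {M : Matrix ι ι F} {v : ι → F} {m n : ℕ} (hmn : m ≤ n)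
    (h : LinearIndependent F (krylov M v n)) : LinearIndependent F (krylov M v m) := by
  induction n, hmn using Nat.le_induction with
  | base => exact h
  | succ n _ ih => exact ih (linearIndependent_krylov_succ_iff.mp h).1

lemma existsUnique_hasCyclicDim (M : Matrix ι ι F) (v : ι → F) :
    ∃! m, m ∈ Finset.range (Fintype.card ι + 1) ∧ HasCyclicDim M v m := by
  classical
  have hle : ∀ m, LinearIndependent F (krylov M v m) → m ≤ Fintype.card ι := fun m h => by
    simpa using h.fintype_card_le_finrank
  have hex : ∃ m, ¬ LinearIndependent F (krylov M v (m + 1)) :=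
    ⟨Fintype.card ι, fun h => by have := hle _ h; omega⟩
  have hli : LinearIndependent F (krylov M v (Nat.find hex)) := by
    rcases h : Nat.find hex with _ | m
    · exact linearIndependent_empty_type
    · exact not_not.mp (Nat.find_min hex (h ▸ Nat.lt_succ_self m))
  refine ⟨Nat.find hex, ⟨Finset.mem_range.mpr (Nat.lt_succ_of_le (hle _ hli)), hli,
    Nat.find_spec hex⟩, fun m ⟨_, h1, h2⟩ => ?_⟩
  refine le_antisymm ?_ (Nat.find_min' hex h2)
  by_contra! hlt
  exact Nat.find_spec hex (linearIndependent_krylov_of_le hlt h1)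

lemma sum_card_hasCyclicDim [Fintype F] (M : Matrix ι ι F) :
    ∑ m ∈ Finset.range (Fintype.card ι + 1), Nat.card {v // HasCyclicDim M v m} =
      Fintype.card F ^ Fintype.card ι := by
  classical
  simp only [Nat.card_eq_fintype_card, Fintype.card_subtype, Finset.card_filter]
  rw [Finset.sum_comm]
  have h1 (v : ι → F) :
      ∑ m ∈ Finset.range (Fintype.card ι + 1), (if HasCyclicDim M v m then 1 else 0) = 1 := by
    rw [← Finset.card_filter, Finset.card_eq_one]
    obtain ⟨m, hm, hu⟩ := existsUnique_hasCyclicDim M v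
    refine ⟨m, ?_⟩
    ext m'
    rw [Finset.mem_filter, Finset.mem_singleton]
    exact ⟨hu m', fun h => h ▸ hm⟩
  simp [h1]

lemma hasCyclicDim_zero_iff {M : Matrix ι ι F} {v : ι → F} : HasCyclicDim M v 0 ↔ v = 0 := by
  rw [HasCyclicDim, linearIndependent_krylov_succ_iff]
  simp

lemma exists_companion_iff {M : Matrix ι ι F} {m : ℕ} {u : Fin (m + 1) → ι → F}
    (hu : LinearIndependent F u) :
    (∃ a : Fin (m + 1) → F, ∀ j, M *ᵥ u j = ∑ i, companion a i j • u i) ↔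
      ∃ v, HasCyclicDim M v (m + 1) ∧ ∀ i, u i = krylov M v (m + 1) i := by
  have key (a : Fin (m + 1) → F) : (∀ j, M *ᵥ u j = ∑ i, companion a i j • u i) ↔
      (∀ j : Fin m, M *ᵥ u j.castSucc = u j.succ) ∧ M *ᵥ u (Fin.last m) = ∑ i, -a i • u i := by
    rw [Fin.forall_fin_succ']
    simp [companion_apply_last, companion_apply_castSucc]
  have hspan (v) (huv : ∀ i, u i = krylov M v (m + 1) i) :
      (M ^ (m + 1)) *ᵥ v ∈ Submodule.span F (Set.range (krylov M v (m + 1))) ↔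
        ∃ a : Fin (m + 1) → F, M *ᵥ u (Fin.last m) = ∑ i, -a i • u i := by
    have h1 : M *ᵥ u (Fin.last m) = (M ^ (m + 1)) *ᵥ v := by
      rw [huv, krylov, mulVec_mulVec, Fin.val_last, pow_succ']
    rw [← funext huv, h1, Submodule.mem_span_range_iff_exists_fun]
    constructor
    · rintro ⟨c, hc⟩
      exact ⟨-c, by simp [← hc]⟩
    · rintro ⟨c, hc⟩
      exact ⟨-c, by simp [hc]⟩
  simp only [key]
  constructor
  · rintro ⟨a, h1, h2⟩
    have huv : ∀ i, u i = krylov M (u 0) (m + 1) i := by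
      intro i
      induction i using Fin.induction with
      | zero => simp [krylov]
      | succ i ih =>
        rw [← h1, ih, krylov, krylov, mulVec_mulVec, Fin.val_succ, pow_succ', Fin.val_castSucc]
    refine ⟨u 0, ⟨by rwa [← funext huv], ?_⟩, huv⟩
    rw [linearIndependent_krylov_succ_iff, hspan _ huv]
    exact fun h => h.2 ⟨a, h2⟩
  · rintro ⟨v, ⟨h1, h2⟩, huv⟩
    rw [linearIndependent_krylov_succ_iff, not_and, not_not, hspan _ huv] at h2
    obtain ⟨a, ha⟩ := h2 h1
    refine ⟨a, fun j => ?_, ha⟩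
    rw [huv, huv, krylov, krylov, mulVec_mulVec, Fin.val_succ, pow_succ', Fin.val_castSucc]

lemma exists_mul_eq_mul_fromBlocks_iff {m k : ℕ}
    {M : Matrix (Fin (m + 1) ⊕ Fin k) (Fin (m + 1) ⊕ Fin k) F}
    (g : GL (Fin (m + 1) ⊕ Fin k) F) (a : Fin (m + 1) → F) :
    (∃ B D, M * g.1 = g.1 * fromBlocks (companion a) B 0 D) ↔
      ∀ j, M *ᵥ g.1.col (Sum.inl j) = ∑ i, companion a i j • g.1.col (Sum.inl i) := by
  have h1 (j : Fin (m + 1)) (B : Matrix _ (Fin k) F) (D : Matrix _ (Fin k) F) :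
      ∑ i, companion a i j • g.1.col (Sum.inl i) =
      g.1 *ᵥ (fromBlocks (companion a) B (0 : Matrix (Fin k) _ F) D).col (Sum.inl j) := by
    ext l
    simp [mulVec, dotProduct, mul_comm]
  constructor
  · rintro ⟨B, D, h⟩ j
    rw [h1 j B D]
    exact congrArg (fun N : Matrix _ _ F => N.col (Sum.inl j)) h
  · intro h
    set T := g⁻¹.1 * M * g.1 with hT
    have hgT : g.1 * T = M * g.1 := by
      rw [hT, ← mul_assoc, ← mul_assoc, Units.mul_inv, one_mul]
    have hcol (j : Fin (m + 1)) : T.col (Sum.inl j) =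
        (fromBlocks (companion a) 0 (0 : Matrix (Fin k) _ F) (0 : Matrix _ (Fin k) F)).col
          (Sum.inl j) := by
      refine mulVec_injective_of_isUnit g.isUnit ?_
      change g.1 *ᵥ _ = g.1 *ᵥ _
      rw [← h1, ← h]
      exact congrArg (fun N : Matrix _ _ F => N.col (Sum.inl j)) hgT
    refine ⟨T.toBlocks₁₂, T.toBlocks₂₂, ?_⟩
    rw [← hgT]
    congr 1
    have h11 : T.toBlocks₁₁ = companion a := by
      ext i j
      exact congrFun (hcol j) (Sum.inl i)
    have h21 : T.toBlocks₂₁ = 0 := by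
      ext i j
      exact congrFun (hcol j) (Sum.inr i)
    rw [← h11, ← h21, fromBlocks_toBlocks]

end Krylov

end TracePowers

namespace TracePowers

open Polynomial Matrix

section Reindex

variable {F : Type*} [Field F] {ι κ : Type*} [Fintype ι] [DecidableEq ι] [Fintype κ]
  [DecidableEq κ]

lemma krylov_reindex (e : ι ≃ κ) (M : Matrix ι ι F) (v : ι → F) (m : ℕ) :
    krylov (reindexAlgEquiv F F e M) (LinearEquiv.funCongrLeft F F e.symm v) m =
      LinearEquiv.funCongrLeft F F e.symm ∘ krylov M v m := by
  ext i j
  simp only [krylov, ← map_pow, Function.comp_apply, LinearEquiv.funCongrLeft_apply]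
  simp only [coe_reindexAlgEquiv, reindex_apply, LinearMap.funLeft_apply, mulVec, dotProduct,
    submatrix_apply]
  exact e.symm.sum_comp fun l => (M ^ (i : ℕ)) (e.symm j) l * v l

lemma hasCyclicDim_reindex_iff (e : ι ≃ κ) {M : Matrix ι ι F} {v : ι → F} {m : ℕ} :
    HasCyclicDim (reindexAlgEquiv F F e M) (LinearEquiv.funCongrLeft F F e.symm v) m ↔
      HasCyclicDim M v m := by
  simp only [HasCyclicDim, krylov_reindex]
  rw [← LinearEquiv.coe_toLinearMap, LinearMap.linearIndependent_iff _ (LinearEquiv.ker _),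
    LinearMap.linearIndependent_iff _ (LinearEquiv.ker _)]

lemma card_hasCyclicDim_reindex (e : ι ≃ κ) (M : Matrix ι ι F) (m : ℕ) :
    Nat.card {v // HasCyclicDim (reindexAlgEquiv F F e M) v m} =
      Nat.card {v // HasCyclicDim M v m} :=
  (Nat.card_congr ((LinearEquiv.funCongrLeft F F e.symm).toEquiv.subtypeEquiv fun _ =>
    (hasCyclicDim_reindex_iff e).symm)).symm

end Reindex

section Recursion

variable {F : Type*} [Field F] [Fintype F]

lemma card_exists_mul_eq_mul_fromBlocks {m k : ℕ}
    (M : Matrix (Fin (m + 1) ⊕ Fin k) (Fin (m + 1) ⊕ Fin k) F) :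
    Nat.card {g : GL (Fin (m + 1) ⊕ Fin k) F // ∃ a B D,
        M * g.1 = g.1 * fromBlocks (companion a) B 0 D} =
      Nat.card {v // HasCyclicDim M v (m + 1)} *
        (Fintype.card F ^ ((m + 1) * k) * Nat.card (GL (Fin k) F)) := by
  classical
  have hind (g : GL (Fin (m + 1) ⊕ Fin k) F) :
      LinearIndependent F fun i : Fin (m + 1) => g.1.col (Sum.inl i) :=
    (linearIndependent_cols_iff_isUnit.mpr g.isUnit).comp _ Sum.inl_injective
  have h1 (g : GL (Fin (m + 1) ⊕ Fin k) F) :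
      (∃ a B D, M * g.1 = g.1 * fromBlocks (companion a) B 0 D) ↔
        ∃ v, HasCyclicDim M v (m + 1) ∧ ∀ i, g.1.col (Sum.inl i) = krylov M v (m + 1) i := by
    rw [← exists_companion_iff (hind g)]
    exact exists_congr fun a => exists_mul_eq_mul_fromBlocks_iff g a
  let Φ (x : Σ v : {v // HasCyclicDim M v (m + 1)}, {g : GL (Fin (m + 1) ⊕ Fin k) F //
      ∀ i, g.1.col (Sum.inl i) = krylov M v.1 (m + 1) i}) :
      {g : GL (Fin (m + 1) ⊕ Fin k) F // ∃ a B D,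
        M * g.1 = g.1 * fromBlocks (companion a) B 0 D} :=
    ⟨x.2.1, (h1 _).mpr ⟨x.1.1, x.1.2, x.2.2⟩⟩
  have hΦ : Function.Bijective Φ := by
    constructor
    · rintro ⟨⟨v, hv⟩, ⟨g, hg⟩⟩ ⟨⟨v', hv'⟩, ⟨g', hg'⟩⟩ h
      obtain rfl : g = g' := congrArg Subtype.val h
      obtain rfl : v = v' := by
        have h2 := (hg 0).symm.trans (hg' 0)
        simpa [krylov] using h2
      rfl
    · rintro ⟨g, hg⟩
      obtain ⟨v, hv, hvg⟩ := (h1 g).mp hg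
      exact ⟨⟨⟨v, hv⟩, ⟨g, hvg⟩⟩, rfl⟩
  rw [← Nat.card_eq_of_bijective Φ hΦ, Nat.card_sigma,
    Finset.sum_congr rfl fun v _ => card_col_eq v.2.1]
  simp

variable {χ : F[X] → ℂ}

/-- The sum of a function of the characteristic polynomial over all matrices. -/
noncomputable def matSum (χ : F[X] → ℂ) (ι : Type*) [Fintype ι] [DecidableEq ι] : ℂ :=
  ∑ M : Matrix ι ι F, χ M.charpoly

lemma sum_mul_card_exists (hχ : ∀ f g : F[X], f.Monic → g.Monic → χ (f * g) = χ f * χ g)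
    (m k : ℕ) :
    ∑ M : Matrix (Fin (m + 1) ⊕ Fin k) (Fin (m + 1) ⊕ Fin k) F, χ M.charpoly *
      (Nat.card {g : GL (Fin (m + 1) ⊕ Fin k) F // ∃ a B D,
        M * g.1 = g.1 * fromBlocks (companion a) B 0 D} : ℂ) =
    Nat.card (GL (Fin (m + 1) ⊕ Fin k) F) * (Fintype.card F ^ ((m + 1) * k) *
      ((∑ a : Fin (m + 1) → F, χ (companion a).charpoly) * matSum χ (Fin k))) := by
  classical
  have h1 (M : Matrix (Fin (m + 1) ⊕ Fin k) (Fin (m + 1) ⊕ Fin k) F) : χ M.charpoly *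
      (Nat.card {g : GL (Fin (m + 1) ⊕ Fin k) F // ∃ a B D,
        M * g.1 = g.1 * fromBlocks (companion a) B 0 D} : ℂ) =
      ∑ g : GL (Fin (m + 1) ⊕ Fin k) F,
        if ∃ a B D, M * g.1 = g.1 * fromBlocks (companion a) B 0 D then χ M.charpoly else 0 := by
    rw [Nat.card_eq_fintype_card, Fintype.card_subtype, ← Finset.sum_filter, Finset.sum_const,
      nsmul_eq_mul, mul_comm]
  rw [Finset.sum_congr rfl fun M _ => h1 M, Finset.sum_comm]
  have h2 (g : GL (Fin (m + 1) ⊕ Fin k) F) :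
      (∑ M : Matrix (Fin (m + 1) ⊕ Fin k) (Fin (m + 1) ⊕ Fin k) F,
        if ∃ a B D, M * g.1 = g.1 * fromBlocks (companion a) B 0 D then χ M.charpoly else 0) =
      ∑ x : (Fin (m + 1) → F) × Matrix (Fin (m + 1)) (Fin k) F × Matrix (Fin k) (Fin k) F,
        χ (companion x.1).charpoly * χ x.2.2.charpoly := by
    rw [← Finset.sum_filter]
    symm
    refine Finset.sum_bij
      (fun x _ => g.1 * fromBlocks (companion x.1) x.2.1 0 x.2.2 * g⁻¹.1) ?_ ?_ ?_ ?_
    · intro x _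
      refine Finset.mem_filter.mpr ⟨Finset.mem_univ _, x.1, x.2.1, x.2.2, ?_⟩
      rw [mul_assoc, Units.inv_mul, mul_one]
    · intro x _ y _ hxy
      have h3 := g.isUnit.mul_left_cancel (g⁻¹.isUnit.mul_right_cancel hxy)
      rw [fromBlocks_inj] at h3
      refine Prod.ext (funext fun i => ?_) (Prod.ext h3.2.1 h3.2.2.2)
      rw [← coeff_charpoly_companion x.1, h3.1, coeff_charpoly_companion]
    · intro M hM
      obtain ⟨a, B, D, h⟩ := (Finset.mem_filter.mp hM).2
      refine ⟨(a, B, D), Finset.mem_univ _, ?_⟩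
      rw [← h, mul_assoc, Units.mul_inv, mul_one]
    · intro x _
      rw [coe_units_inv, charpoly_units_conj, charpoly_fromBlocks_zero₂₁,
        hχ _ _ (charpoly_monic _) (charpoly_monic _)]
  rw [Finset.sum_congr rfl fun g _ => h2 g, Finset.sum_const, nsmul_eq_mul, Finset.card_univ,
    Nat.card_eq_fintype_card]
  congr 1
  rw [Fintype.sum_prod_type, Finset.sum_mul, Finset.mul_sum]
  refine Finset.sum_congr rfl fun a _ => ?_
  rw [Fintype.sum_prod_type]
  dsimp only
  rw [Finset.sum_const, ← Finset.mul_sum, nsmul_eq_mul, Finset.card_univ,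
    ← Nat.card_eq_fintype_card, matSum]
  congr 1
  simp [Matrix, pow_mul']

lemma sum_mul_card_hasCyclicDim
    (hχ : ∀ f g : F[X], f.Monic → g.Monic → χ (f * g) = χ f * χ g) (m k : ℕ) :
    (∑ M : Matrix (Fin (m + 1 + k)) (Fin (m + 1 + k)) F, χ M.charpoly *
      (Nat.card {v // HasCyclicDim M v (m + 1)} : ℂ)) * Nat.card (GL (Fin k) F) =
    Nat.card (GL (Fin (m + 1 + k)) F) *
      ((∑ a : Fin (m + 1) → F, χ (companion a).charpoly) * matSum χ (Fin k)) := by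
  have h := sum_mul_card_exists hχ m k
  have hGL : Nat.card (GL (Fin (m + 1 + k)) F) = Nat.card (GL (Fin (m + 1) ⊕ Fin k) F) :=
    (Nat.card_congr (Units.mapEquiv
      (reindexAlgEquiv F F (finSumFinEquiv (m := m + 1) (n := k))).toMulEquiv).toEquiv).symm
  have hM : ∑ M : Matrix (Fin (m + 1) ⊕ Fin k) (Fin (m + 1) ⊕ Fin k) F, χ M.charpoly *
      (Nat.card {v // HasCyclicDim M v (m + 1)} : ℂ) =
      ∑ M : Matrix (Fin (m + 1 + k)) (Fin (m + 1 + k)) F, χ M.charpoly *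
        (Nat.card {v // HasCyclicDim M v (m + 1)} : ℂ) :=
    Fintype.sum_equiv (reindexAlgEquiv F F finSumFinEquiv).toEquiv _ _ fun M => by
      rw [AlgEquiv.toEquiv_eq_coe, EquivLike.coe_coe, card_hasCyclicDim_reindex,
        coe_reindexAlgEquiv, charpoly_reindex]
  simp only [card_exists_mul_eq_mul_fromBlocks] at h
  have hq : (Fintype.card F : ℂ) ^ ((m + 1) * k) ≠ 0 :=
    pow_ne_zero _ (Nat.cast_ne_zero.mpr Fintype.card_ne_zero)
  rw [hGL, ← hM]
  refine mul_left_cancel₀ hq ?_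
  push_cast at h
  rw [mul_left_comm (_ ^ _) (Nat.card _ : ℂ), ← h, Finset.sum_mul, Finset.mul_sum]
  exact Finset.sum_congr rfl fun M _ => by ring

/-- The mean over `GL_n(F)` of a function of the characteristic polynomial. -/
noncomputable def glMean (χ : F[X] → ℂ) (n : ℕ) : ℂ :=
  matSum χ (Fin n) / Nat.card (GL (Fin n) F)

lemma card_pow_mul_glMean (hχ : ∀ f g : F[X], f.Monic → g.Monic → χ (f * g) = χ f * χ g) (n : ℕ) :
    (Fintype.card F : ℂ) ^ n * glMean χ n = glMean χ n + ∑ m ∈ Finset.range n,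
      (∑ a : Fin (m + 1) → F, χ (companion a).charpoly) * glMean χ (n - (m + 1)) := by
  have hne (k : ℕ) : (Nat.card (GL (Fin k) F) : ℂ) ≠ 0 := by
    exact_mod_cast Nat.card_pos.ne'
  have h1 (M : Matrix (Fin n) (Fin n) F) : (Fintype.card F : ℂ) ^ n =
      1 + ∑ m ∈ Finset.range n, (Nat.card {v // HasCyclicDim M v (m + 1)} : ℂ) := by
    have h2 := sum_card_hasCyclicDim M
    rw [Finset.sum_range_succ', Fintype.card_fin] at h2
    simp only [hasCyclicDim_zero_iff] at h2
    rw [add_comm]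
    exact_mod_cast (by simpa using h2.symm)
  have h3 : (Fintype.card F : ℂ) ^ n * matSum χ (Fin n) = matSum χ (Fin n) +
      ∑ m ∈ Finset.range n, ∑ M : Matrix (Fin n) (Fin n) F,
        χ M.charpoly * (Nat.card {v // HasCyclicDim M v (m + 1)} : ℂ) := by
    rw [Finset.sum_comm, matSum, Finset.mul_sum, ← Finset.sum_add_distrib]
    refine Finset.sum_congr rfl fun M _ => ?_
    rw [h1 M, ← Finset.mul_sum]
    ring
  rw [glMean, mul_div_assoc', h3, add_div, Finset.sum_div]
  congr 1
  refine Finset.sum_congr rfl fun m hm => ?_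
  obtain ⟨k, rfl⟩ := Nat.exists_eq_add_of_le (Nat.succ_le_of_lt (Finset.mem_range.mp hm))
  have h4 := sum_mul_card_hasCyclicDim hχ m k
  rw [Nat.succ_eq_add_one, Nat.add_sub_cancel_left, glMean, div_eq_iff (hne _)]
  rw [← eq_div_iff (hne _)] at h4
  rw [h4]
  ring

end Recursion

end TracePowers

namespace TracePowers

open Polynomial Matrix

section TracePow

variable {K : Type*} [Field K]

lemma exists_fromBlocks_pow {R m n : Type*} [CommRing R] [Fintype m] [DecidableEq m] [Fintype n]
    [DecidableEq n] (A : Matrix m m R) (B : Matrix m n R) (D : Matrix n n R) (k : ℕ) :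
    ∃ B', fromBlocks A B 0 D ^ k = fromBlocks (A ^ k) B' 0 (D ^ k) := by
  induction k with
  | zero => exact ⟨0, by simp⟩
  | succ k ih =>
    obtain ⟨B', h⟩ := ih
    exact ⟨A ^ k * B + B' * D, by simp [pow_succ, h, fromBlocks_multiply]⟩

lemma exists_mul_eq_mul_fromBlocks_diagonal [IsAlgClosed K] {n : ℕ}
    (N : Matrix (Fin 1 ⊕ Fin n) (Fin 1 ⊕ Fin n) K) :
    ∃ (g : GL (Fin 1 ⊕ Fin n) K) (μ : K) (B : _) (D : _),
      N * g.1 = g.1 * fromBlocks (diagonal fun _ => μ) B 0 D := by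
  obtain ⟨μ, hμ⟩ := IsAlgClosed.exists_root N.charpoly (by
    rw [charpoly_degree_eq_dim]
    exact_mod_cast Fintype.card_ne_zero)
  rw [IsRoot, eval_charpoly, ← exists_mulVec_eq_zero_iff] at hμ
  obtain ⟨v, hv, hNv⟩ := hμ
  rw [sub_mulVec, sub_eq_zero] at hNv
  have hvl : LinearIndependent K (fun _ : Fin 1 => v) := by
    rw [linearIndependent_unique_iff]
    exact hv
  obtain ⟨g, hg⟩ := exists_col_eq hvl
  have hc : companion (fun _ : Fin (0 + 1) => -μ) = diagonal fun _ => μ := by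
    ext i j
    fin_cases i
    fin_cases j
    simpa using companion_apply_last (fun _ : Fin (0 + 1) => -μ) 0
  obtain ⟨B, D, h⟩ := (exists_mul_eq_mul_fromBlocks_iff (M := N) g (fun _ => -μ)).mpr (by
    intro j
    fin_cases j
    simp [hc, hg, diagonal_apply, ← hNv])
  exact ⟨g, μ, B, D, by rwa [hc] at h⟩

lemma trace_pow_eq_sum_roots_charpoly [IsAlgClosed K] {n : ℕ} (N : Matrix (Fin n) (Fin n) K)
    (k : ℕ) : (N ^ k).trace = (N.charpoly.roots.map (· ^ k)).sum := by
  induction n with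
  | zero => simp
  | succ n ih =>
    let e : Fin (n + 1) ≃ Fin 1 ⊕ Fin n := (finCongr (Nat.add_comm n 1)).trans finSumFinEquiv.symm
    set N' := reindexAlgEquiv K K e N with hN'
    have htr (A : Matrix (Fin (n + 1)) (Fin (n + 1)) K) :
        (reindexAlgEquiv K K e A).trace = A.trace := by
      simp only [coe_reindexAlgEquiv, reindex_apply, trace, diag, submatrix_apply]
      exact e.symm.sum_comp fun i => A i i
    have htb (A : Matrix (Fin 1) (Fin 1) K) (B D) :
        (fromBlocks A B 0 D : Matrix (Fin 1 ⊕ Fin n) (Fin 1 ⊕ Fin n) K).trace =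
          A.trace + D.trace := by
      simp [trace]
    have hcp : N'.charpoly = N.charpoly := by rw [hN', coe_reindexAlgEquiv, charpoly_reindex]
    obtain ⟨g, μ, B, D, h⟩ := exists_mul_eq_mul_fromBlocks_diagonal N'
    have hNg : N' = g.1 * fromBlocks (diagonal fun _ => μ) B 0 D * g⁻¹.1 := by
      rw [← h, mul_assoc, Units.mul_inv, mul_one]
    obtain ⟨B', hB'⟩ := exists_fromBlocks_pow (diagonal fun _ : Fin 1 => μ) B D k
    rw [← htr, map_pow, ← hN', ← hcp, hNg, Units.conj_pow, hB', trace_units_conj,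
      coe_units_inv, charpoly_units_conj, charpoly_fromBlocks_zero₂₁, roots_mul, htb,
      ih, Multiset.map_add, Multiset.sum_add, diagonal_pow, charpoly_diagonal]
    · simp
    · exact ((charpoly_monic _).mul (charpoly_monic _)).ne_zero

end TracePow

section RootSum

variable {F : Type*} [Field F] [Finite F] {K : Type*} [Field K] [Algebra F K] [IsAlgClosed K]

lemma algebraMap_trace_zpow {n : ℕ} (M : GL (Fin n) F) (b : ℤ) :
    algebraMap F K (Matrix.trace (M ^ b).1) = ((M.1.charpoly.aroots K).map (· ^ b)).sum := by
  set e := orderOf M with he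
  have he0 : 0 < e := orderOf_pos M
  obtain ⟨k, hk⟩ := Int.eq_ofNat_of_zero_le (Int.emod_nonneg b (Int.natCast_ne_zero.mpr he0.ne'))
  have hMb : M ^ b = M ^ k := by
    rw [← zpow_natCast, ← hk, he, zpow_mod_orderOf]
  set N := M.1.map (algebraMap F K) with hN
  have hroots : M.1.charpoly.aroots K = N.charpoly.roots := by
    rw [hN, charpoly_map, aroots]
  have hpow (j : ℕ) : (M.1 ^ j).map (algebraMap F K) = N ^ j := by
    rw [hN, ← RingHom.mapMatrix_apply, map_pow, RingHom.mapMatrix_apply]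
  have hρ : ∀ ρ ∈ N.charpoly.roots, ρ ^ e = 1 := by
    intro ρ h
    rcases n with _ | n
    · simp at h
    have hNe : N ^ e = 1 := by
      rw [← hpow, ← Units.val_pow_eq_pow_val, pow_orderOf_eq_one, Units.val_one,
        Matrix.map_one _ (map_zero _) (map_one _)]
    have h1 := spectrum.pow_mem_pow N e
      (mem_spectrum_iff_isRoot_charpoly.mpr (isRoot_of_mem_roots h))
    rwa [hNe, spectrum.one_eq, Set.mem_singleton_iff] at h1
  rw [hMb, Units.val_pow_eq_pow_val, hroots, AddMonoidHom.map_trace, hpow,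
    trace_pow_eq_sum_roots_charpoly]
  congr 1
  refine Multiset.map_congr rfl fun ρ h => ?_
  have hρ0 : ρ ≠ 0 := by
    rintro rfl
    simpa [he0.ne'] using hρ 0 h
  change ρ ^ k = ρ ^ b
  rw [← Int.mul_ediv_add_emod b e, hk, zpow_add₀ hρ0, _root_.zpow_mul, zpow_natCast,
    hρ ρ h, _root_.one_zpow,
    one_mul, zpow_natCast]

end RootSum

end TracePowers

namespace TracePowers

open Polynomial Matrix

section GLMean

variable {F : Type*} [Field F] [Fintype F] {K : Type*} [Field K] [Algebra F K]

variable (ψ : AddChar F ℂ) (τ : K →ₗ[F] F) (c : ℤ →₀ F)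

/-- `polyChar`, extended by zero to polynomials with zero constant coefficient. -/
noncomputable def polyCharZero (h : F[X]) : ℂ :=
  open scoped Classical in if h.coeff 0 ≠ 0 then polyChar ψ τ c h else 0

variable {ψ τ c}

omit [Fintype F] in
lemma polyCharZero_mul {f g : F[X]} (hf : f.Monic) (hg : g.Monic) :
    polyCharZero ψ τ c (f * g) = polyCharZero ψ τ c f * polyCharZero ψ τ c g := by
  rw [polyCharZero, polyCharZero, polyCharZero, mul_coeff_zero]
  by_cases h1 : f.coeff 0 = 0
  · simp [h1]
  by_cases h2 : g.coeff 0 = 0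
  · simp [h2]
  rw [if_pos (mul_ne_zero h1 h2), if_pos h1, if_pos h2, polyChar_mul (hf.mul hg).ne_zero]

lemma sum_polyCharZero_companion (m : ℕ) :
    ∑ a : Fin (m + 1) → F, polyCharZero ψ τ c (companion a).charpoly = lCoeff ψ τ c (m + 1) := by
  classical
  have h0 (a : Fin (m + 1) → F) : (companion a).charpoly.coeff 0 = a 0 :=
    coeff_charpoly_companion a 0
  simp only [polyCharZero, h0]
  rw [← Finset.sum_filter, lCoeff]
  refine Finset.sum_bij (fun a _ => (companion a).charpoly) ?_ ?_ ?_ ?_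
  · intro a ha
    refine mem_monicSet.mpr ⟨charpoly_monic _, by simp, ?_⟩
    rw [h0]
    exact (Finset.mem_filter.mp ha).2
  · intro a _ a' _ h
    ext i
    rw [← coeff_charpoly_companion a, h, coeff_charpoly_companion]
  · intro h hh
    obtain ⟨hm, hd, h00⟩ := mem_monicSet.mp hh
    refine ⟨fun i => h.coeff i, Finset.mem_filter.mpr ⟨Finset.mem_univ _, by simpa using h00⟩, ?_⟩
    set A := companion fun i : Fin (m + 1) => h.coeff i with hA
    have hAd : A.charpoly.natDegree = m + 1 := by simp
    ext i
    rcases lt_trichotomy i (m + 1) with hi | rfl | hi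
    · exact coeff_charpoly_companion _ (⟨i, hi⟩ : Fin (m + 1))
    · have h1 := (charpoly_monic A).coeff_natDegree
      have h2 := hm.coeff_natDegree
      rw [hAd] at h1
      rw [hd] at h2
      rw [h1, h2]
    · rw [coeff_eq_zero_of_natDegree_lt (by rwa [hAd]), coeff_eq_zero_of_natDegree_lt (by rwa [hd])]
  · intro a _
    rfl

/-- The means of a character of traces satisfy a recursion with the coefficients of the
`L`-function. -/
lemma card_pow_mul_glMean_polyCharZero (n : ℕ) :
    (Fintype.card F : ℂ) ^ n * glMean (polyCharZero ψ τ c) n =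
      glMean (polyCharZero ψ τ c) n + ∑ m ∈ Finset.range n,
        lCoeff ψ τ c (m + 1) * glMean (polyCharZero ψ τ c) (n - (m + 1)) := by
  rw [card_pow_mul_glMean fun f g hf hg => polyCharZero_mul hf hg]
  simp only [sum_polyCharZero_companion]

lemma glMean_polyCharZero_zero : glMean (polyCharZero ψ τ c) 0 = 1 := by
  simp [glMean, matSum, polyCharZero, polyChar, rootSum, Fintype.card_eq_one_iff_nonempty_unique]
  exact ⟨⟨⟨0⟩, fun _ => Subsingleton.elim _ _⟩⟩

variable [IsAlgClosed K]

lemma polyChar_charpoly (hτ : ∀ a, τ (algebraMap F K a) = a) {n : ℕ} (M : GL (Fin n) F) :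
    polyChar ψ τ c M.1.charpoly = ψ (∑ b ∈ c.support, c b * Matrix.trace (M ^ b).1) := by
  rw [polyChar, rootSum_eq_sum, ← hτ (∑ b ∈ c.support, c b * Matrix.trace (M ^ b).1),
    map_sum (algebraMap F K)]
  simp only [map_mul (algebraMap F K), algebraMap_trace_zpow]

lemma glMean_polyCharZero [DecidableEq F] (hτ : ∀ a, τ (algebraMap F K a) = a) (n : ℕ) :
    glMean (polyCharZero ψ τ c) n =
      (∑ M : GL (Fin n) F, ψ (∑ b ∈ c.support, c b * Matrix.trace (M ^ b).1)) /
        Nat.card (GL (Fin n) F) := by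
  rw [glMean, matSum]
  congr 1
  have h0 (M : Matrix (Fin n) (Fin n) F) : M.charpoly.coeff 0 ≠ 0 ↔ IsUnit M := by
    rw [isUnit_iff_isUnit_det, isUnit_iff_ne_zero, det_eq_sign_charpoly_coeff]
    simp
  simp only [polyCharZero, h0]
  rw [← Finset.sum_filter]
  symm
  refine Finset.sum_bij (fun M _ => M.1) ?_ ?_ ?_ ?_
  · intro M _
    simp
  · intro M _ N _ h
    exact Units.ext h
  · intro M hM
    have hu : IsUnit M := by simpa using hM
    exact ⟨hu.unit, Finset.mem_univ _, rfl⟩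
  · intro M _
    exact (polyChar_charpoly hτ M).symm

end GLMean

end TracePowers

namespace TracePowers

open PowerSeries

section QExp

/-- The solution of `f(QX) = (1 - aX) f(X)` with constant coefficient one. -/
noncomputable def qExp (Q : ℝ) (a : ℂ) : ℂ⟦X⟧ :=
  mk fun n => ∏ i ∈ Finset.range n, (-a) / ((Q : ℂ) ^ (i + 1) - 1)

lemma pow_sub_one_ne_zero {Q : ℝ} (hQ : 1 < Q) (n : ℕ) : (Q : ℂ) ^ (n + 1) - 1 ≠ 0 := by
  have h : Q ^ (n + 1) - 1 ≠ 0 := (sub_pos.mpr (one_lt_pow₀ hQ n.succ_ne_zero)).ne'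
  exact_mod_cast h

lemma coeff_qExp_succ (Q : ℝ) (a : ℂ) (n : ℕ) :
    coeff (n + 1) (qExp Q a) = coeff n (qExp Q a) * ((-a) / ((Q : ℂ) ^ (n + 1) - 1)) := by
  rw [qExp, coeff_mk, coeff_mk, Finset.prod_range_succ]

lemma rescale_qExp {Q : ℝ} (hQ : 1 < Q) (a : ℂ) :
    rescale (Q : ℂ) (qExp Q a) = (1 - C a * X) * qExp Q a := by
  ext n
  rw [coeff_rescale, sub_mul, one_mul, map_sub, mul_assoc, coeff_C_mul]
  cases n with
  | zero => simp
  | succ n =>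
    rw [coeff_succ_X_mul, coeff_qExp_succ]
    have := pow_sub_one_ne_zero hQ n
    field_simp
    ring

lemma norm_coeff_qExp_le {Q : ℝ} (hQ : 1 < Q) {a : ℂ} (ha : ‖a‖ ^ 2 ≤ Q) (n : ℕ) :
    ‖coeff n (qExp Q a)‖ ≤ (1 + 1 / (Q - 1)) ^ n * Q ^ (-(n : ℝ) ^ 2 / 2) := by
  have hQ0 : 0 < Q := by linarith
  induction n with
  | zero => simp [qExp]
  | succ n ih =>
    have hn : 1 ≤ Q ^ n := one_le_pow₀ hQ.le
    have hpos : 0 < Q ^ (n + 1) - 1 := sub_pos.mpr (one_lt_pow₀ hQ n.succ_ne_zero)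
    have hden : ‖(Q : ℂ) ^ (n + 1) - 1‖ = Q ^ (n + 1) - 1 := by
      rw [← abs_of_pos hpos, ← Real.norm_eq_abs, ← Complex.norm_real]
      push_cast
      rfl
    have hasq : ‖a‖ ≤ Q ^ (1 / 2 : ℝ) := by
      rw [← Real.sqrt_eq_rpow]
      exact Real.le_sqrt_of_sq_le ha
    have hinv : (Q ^ (n + 1) - 1)⁻¹ ≤ (1 + 1 / (Q - 1)) * Q ^ (-((n : ℝ) + 1)) := by
      rw [Real.rpow_neg hQ0.le, ← Nat.cast_add_one, Real.rpow_natCast, ← div_eq_mul_inv,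
        le_div_iff₀ (by positivity), inv_mul_le_iff₀ hpos]
      have h1 : 0 < Q - 1 := by linarith
      rw [one_add_div h1.ne', mul_div_assoc', le_div_iff₀ h1]
      ring_nf
      ring_nf at hn
      nlinarith
    rw [coeff_qExp_succ, norm_mul, norm_div, norm_neg, hden, div_eq_mul_inv]
    calc _ ≤ ((1 + 1 / (Q - 1)) ^ n * Q ^ (-(n : ℝ) ^ 2 / 2)) *
          (Q ^ (1 / 2 : ℝ) * ((1 + 1 / (Q - 1)) * Q ^ (-((n : ℝ) + 1)))) := by
          have := inv_nonneg.mpr hpos.le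
          gcongr
      _ = (1 + 1 / (Q - 1)) ^ (n + 1) *
          (Q ^ (-(n : ℝ) ^ 2 / 2) * Q ^ (1 / 2 : ℝ) * Q ^ (-((n : ℝ) + 1))) := by ring
      _ = _ := by
        rw [← Real.rpow_add hQ0, ← Real.rpow_add hQ0]
        congr 2
        push_cast
        ring

lemma rpow_mul_rpow_le {Q : ℝ} (hQ : 1 < Q) (i j N : ℕ) :
    Q ^ (-(i : ℝ) ^ 2 / 2) * Q ^ (-(j : ℝ) ^ 2 / (2 * (N + 1))) ≤
      Q ^ (-((i : ℝ) + j) ^ 2 / (2 * (N + 1 + 1))) := by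
  rw [← Real.rpow_add (by linarith)]
  refine Real.rpow_le_rpow_of_exponent_le hQ.le ?_
  rw [div_add_div _ _ (by norm_num) (by positivity),
    div_le_div_iff₀ (by positivity) (by positivity)]
  nlinarith [sq_nonneg ((i : ℝ) * (N + 1) - j)]

lemma sum_antidiagonal_choose (n N : ℕ) :
    ∑ x ∈ Finset.HasAntidiagonal.antidiagonal n, (x.2 + N).choose x.2 = (n + (N + 1)).choose n := by
  rw [← Finset.Nat.sum_antidiagonal_swap, Finset.Nat.sum_antidiagonal_eq_sum_range_succ_mk,
    Nat.choose_symm_add, ← add_assoc, ← Nat.sum_range_add_choose]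
  exact Finset.sum_congr rfl fun i _ => Nat.choose_symm_add

/-- A solution of `f(QX) = ∏ (1 - aX) f(X)` with small coefficients. -/
lemma exists_rescale_eq_revProd {Q : ℝ} (hQ : 1 < Q) (s : Multiset ℂ) (hs : ∀ a ∈ s, ‖a‖ ^ 2 ≤ Q) :
    ∃ f : ℂ⟦X⟧, coeff 0 f = 1 ∧ rescale (Q : ℂ) f = (revProd s : ℂ⟦X⟧) * f ∧
      ∀ n, ‖coeff n f‖ ≤ (n + s.card).choose n * (1 + 1 / (Q - 1)) ^ n *
        Q ^ (-(n : ℝ) ^ 2 / (2 * (s.card + 1))) := by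
  induction s using Multiset.induction_on with
  | empty =>
    refine ⟨1, by simp, by simp [revProd], fun n => ?_⟩
    have : 0 < Q - 1 := by linarith
    rw [coeff_one]
    split_ifs with h
    · simp [h]
    · rw [norm_zero]
      positivity
  | cons a s ih =>
    obtain ⟨f, h0, hf, hb⟩ := ih fun a ha => hs a (Multiset.mem_cons_of_mem ha)
    refine ⟨qExp Q a * f, ?_, ?_, fun n => ?_⟩
    · rw [coeff_zero_eq_constantCoeff_apply] at h0 ⊢
      rw [map_mul, h0, mul_one]
      simp [qExp, ← coeff_zero_eq_constantCoeff_apply]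
    · rw [map_mul, rescale_qExp hQ, hf]
      have : (revProd (a ::ₘ s) : ℂ⟦X⟧) = (1 - C a * X) * (revProd s : ℂ⟦X⟧) := by
        simp [revProd]
      rw [this]
      ring
    · have hr : 0 < 1 + 1 / (Q - 1) := by
        have : 0 < Q - 1 := by linarith
        positivity
      set r := 1 + 1 / (Q - 1)
      have hQ0 : 0 < Q := by linarith
      rw [coeff_mul]
      refine (norm_sum_le _ _).trans ?_
      calc _ ≤ ∑ x ∈ Finset.HasAntidiagonal.antidiagonal n, (x.2 + s.card).choose x.2 *
            (r ^ n * Q ^ (-(n : ℝ) ^ 2 / (2 * (s.card + 1 + 1)))) := by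
            refine Finset.sum_le_sum fun x hx => ?_
            have hx' : x.1 + x.2 = n := Finset.HasAntidiagonal.mem_antidiagonal.mp hx
            rw [norm_mul]
            calc _ ≤ (r ^ x.1 * Q ^ (-(x.1 : ℝ) ^ 2 / 2)) * ((x.2 + s.card).choose x.2 * r ^ x.2 *
                  Q ^ (-(x.2 : ℝ) ^ 2 / (2 * (s.card + 1)))) := by
                  gcongr
                  · exact norm_coeff_qExp_le hQ (hs a (Multiset.mem_cons_self a s)) _
                  · exact hb _
              _ = (x.2 + s.card).choose x.2 * (r ^ (x.1 + x.2) * (Q ^ (-(x.1 : ℝ) ^ 2 / 2) *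
                  Q ^ (-(x.2 : ℝ) ^ 2 / (2 * (s.card + 1))))) := by ring
              _ ≤ _ := by
                rw [← hx']
                push_cast
                gcongr
                exact rpow_mul_rpow_le hQ _ _ _
        _ = _ := by
          rw [← Finset.sum_mul, Multiset.card_cons, mul_assoc]
          push_cast
          congr 1
          rw [← Nat.cast_sum, sum_antidiagonal_choose]

lemma rescale_eq_mul_unique {Q : ℝ} (hQ : 1 < Q) {P f g : ℂ⟦X⟧} (hP : coeff 0 P = 1)
    (h0 : coeff 0 f = coeff 0 g) (hf : rescale (Q : ℂ) f = P * f)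
    (hg : rescale (Q : ℂ) g = P * g) : f = g := by
  suffices ∀ h : ℂ⟦X⟧, coeff 0 h = 0 → rescale (Q : ℂ) h = P * h → h = 0 from
    sub_eq_zero.mp (this _ (by rw [map_sub, h0, sub_self]) (by rw [map_sub, hf, hg, mul_sub]))
  intro h h0 hh
  ext n
  rw [map_zero]
  induction n using Nat.strong_induction_on with
  | _ n ih =>
    cases n with
    | zero => exact h0
    | succ n =>
      have h1 := congrArg (coeff (n + 1)) hh
      rw [coeff_rescale, coeff_mul, Finset.sum_eq_single (0, n + 1), hP, one_mul] at h1
      · refine (mul_eq_zero.mp ?_).resolve_left (pow_sub_one_ne_zero hQ n)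
        rw [sub_mul, one_mul, h1, sub_self]
      · rintro ⟨i, j⟩ hx hne
        have hx' : i + j = n + 1 := Finset.HasAntidiagonal.mem_antidiagonal.mp hx
        have : i ≠ 0 := by
          rintro rfl
          exact hne (by simpa using hx')
        rw [ih j (by omega), mul_zero]
      · simp

/-- Bound for the solution of the recursion defined by a product of linear factors. -/
lemma norm_le_of_recursion {Q : ℝ} (hQ : 1 < Q) (s : Multiset ℂ) (hs : ∀ a ∈ s, ‖a‖ ^ 2 ≤ Q)
    {G : ℕ → ℂ} (h0 : G 0 = 1) (hG : ∀ n, (Q : ℂ) ^ n * G n = G n + ∑ m ∈ Finset.range n,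
      (revProd s).coeff (m + 1) * G (n - (m + 1))) (n : ℕ) :
    ‖G n‖ ≤ (n + s.card).choose n * (1 + 1 / (Q - 1)) ^ n *
      Q ^ (-(n : ℝ) ^ 2 / (2 * (s.card + 1))) := by
  obtain ⟨f, hf0, hf, hb⟩ := exists_rescale_eq_revProd hQ s hs
  have hP : coeff 0 (revProd s : ℂ⟦X⟧) = 1 := by
    rw [Polynomial.coeff_coe, coeff_zero_revProd]
  have : mk G = f := by
    refine rescale_eq_mul_unique hQ hP (by rw [coeff_mk, h0, hf0]) ?_ hf
    ext n
    rw [coeff_rescale, coeff_mk, hG, coeff_mul,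
      Finset.Nat.sum_antidiagonal_eq_sum_range_succ_mk, Finset.sum_range_succ']
    simp only [coeff_mk, Polynomial.coeff_coe, coeff_zero_revProd, one_mul, Nat.sub_zero]
    rw [add_comm]
  rw [← coeff_mk n G, this]
  exact hb n

end QExp

end TracePowers

namespace TracePowers

open Matrix

section Assembly

/-- The bound for the mean of an additive character of a Laurent polynomial of traces, when the
`L`-function has `N` reciprocal roots. -/
noncomputable def meanBound (Q : ℝ) (n N : ℕ) : ℝ :=
  (n + N).choose n * (1 + 1 / (Q - 1)) ^ n * Q ^ (-(n : ℝ) ^ 2 / (2 * (N + 1)))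

lemma meanBound_mono {Q : ℝ} (hQ : 1 < Q) (n : ℕ) {N N' : ℕ} (h : N ≤ N') :
    meanBound Q n N ≤ meanBound Q n N' := by
  have hr : 0 < Q - 1 := by linarith
  unfold meanBound
  gcongr ?_ * _ * ?_
  · exact_mod_cast Nat.choose_le_choose n (by omega)
  · refine Real.rpow_le_rpow_of_exponent_le hQ.le ?_
    rw [neg_div, neg_div, neg_le_neg_iff]
    gcongr

variable {F : Type*} [Field F] [Fintype F] [DecidableEq F]

/-- The sum over `GL n F` of `ψ (∑ c_b tr (M ^ b))`. -/
noncomputable def traceSum (ψ : AddChar F ℂ) (c : ℤ →₀ F) (n : ℕ) : ℂ :=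
  ∑ M : GL (Fin n) F, ψ (c.sum fun b x => x * Matrix.trace (M ^ b).1)

lemma traceSum_neg (ψ : AddChar F ℂ) (c : ℤ →₀ F) (n : ℕ) :
    traceSum ψ (c.embDomain (Equiv.neg ℤ).toEmbedding) n = traceSum ψ c n := by
  unfold traceSum
  rw [← Equiv.sum_comp (Equiv.inv (GL (Fin n) F))]
  refine Finset.sum_congr rfl fun M _ => ?_
  rw [Finsupp.sum_embDomain]
  simp

variable {ψ : AddChar F ℂ} {c : ℤ →₀ F}

lemma norm_traceSum_le_of_leading {p : ℕ} [Fact p.Prime] [CharP F p] {B D : ℕ} (hψ : ψ ≠ 1)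
    (hD0 : 0 < D) (hB : ∀ b ∈ c.support, -(B : ℤ) ≤ b) (hD : ∀ b ∈ c.support, b ≤ D)
    (h0c : (0 : ℤ) ∉ c.support) (hcD : c D ≠ 0) (hpD : ¬ p ∣ D) (n : ℕ) :
    ‖traceSum ψ c n‖ ≤
      Nat.card (GL (Fin n) F) * meanBound (Fintype.card F) n (D + B) := by
  obtain ⟨τ, hτ⟩ := (Algebra.linearMap F (AlgebraicClosure F)).exists_leftInverse_of_injective
    (LinearMap.ker_eq_bot.mpr (algebraMap F (AlgebraicClosure F)).injective)
  replace hτ (a : F) : τ (algebraMap F (AlgebraicClosure F) a) = a := LinearMap.congr_fun hτ a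
  obtain ⟨s, hs, hsq, hL⟩ := exists_multiset_lCoeff hτ hψ hD0 hB hD h0c hcD hpD
  have hrec := norm_le_of_recursion (Q := Fintype.card F) (by exact_mod_cast Fintype.one_lt_card)
    s (by exact_mod_cast hsq) (G := glMean (polyCharZero ψ τ c)) glMean_polyCharZero_zero
    (fun n => by
      simp only [← hL]
      exact_mod_cast card_pow_mul_glMean_polyCharZero n) n
  rw [glMean_polyCharZero hτ, norm_div, Complex.norm_natCast, hs,
    div_le_iff₀ (by exact_mod_cast Nat.card_pos), mul_comm] at hrec
  refine hrec.trans_eq ?_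
  rw [meanBound]

lemma norm_traceSum_le_of_pos {p : ℕ} [Fact p.Prime] [CharP F p] {B D : ℕ} (hψ : ψ ≠ 1)
    (hpos : ∃ b ∈ c.support, 0 < b) (hB : ∀ b ∈ c.support, -(B : ℤ) ≤ b)
    (hD : ∀ b ∈ c.support, b ≤ D) (hp : ∀ b ∈ c.support, ¬ (p : ℤ) ∣ b) (n : ℕ) :
    ‖traceSum ψ c n‖ ≤
      Nat.card (GL (Fin n) F) * meanBound (Fintype.card F) n (D + B) := by
  obtain ⟨b₀, hb₀, hb₀pos⟩ := hpos
  obtain ⟨b, hb, hmax⟩ := c.support.exists_max_image id ⟨b₀, hb₀⟩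
  have hbpos : 0 < b := hb₀pos.trans_le (hmax b₀ hb₀)
  lift b to ℕ using hbpos.le
  refine (norm_traceSum_le_of_leading hψ (by exact_mod_cast hbpos) hB hmax
    (fun h => hp 0 h (dvd_zero _)) (Finsupp.mem_support_iff.mp hb)
    (fun h => hp _ hb (by exact_mod_cast h)) n).trans ?_
  gcongr
  refine meanBound_mono (by exact_mod_cast Fintype.one_lt_card) n ?_
  have := hD _ hb
  omega

/-- Square root cancellation for character sums of traces of powers over `GL n F`. -/
theorem norm_traceSum_le {p : ℕ} [Fact p.Prime] [CharP F p] {B D : ℕ} (hψ : ψ ≠ 1) (hc : c ≠ 0)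
    (hB : ∀ b ∈ c.support, -(B : ℤ) ≤ b) (hD : ∀ b ∈ c.support, b ≤ D)
    (hp : ∀ b ∈ c.support, ¬ (p : ℤ) ∣ b) (n : ℕ) :
    ‖traceSum ψ c n‖ ≤
      Nat.card (GL (Fin n) F) * meanBound (Fintype.card F) n (D + B) := by
  by_cases hpos : ∃ b ∈ c.support, 0 < b
  · exact norm_traceSum_le_of_pos hψ hpos hB hD hp n
  push Not at hpos
  obtain ⟨b, hb⟩ := Finsupp.support_nonempty_iff.mpr hc
  have hb0 : b ≠ 0 := by
    rintro rfl
    exact hp 0 hb (dvd_zero _)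
  rw [← traceSum_neg, add_comm D B]
  refine norm_traceSum_le_of_pos (p := p) hψ ⟨-b, ?_, ?_⟩ ?_ ?_ ?_ n
  · simpa using hb
  · have := hpos b hb
    omega
  all_goals
    intro e he
    rw [Finsupp.support_embDomain, Finset.mem_map] at he
    obtain ⟨e', he', rfl⟩ := he
    simp only [Equiv.toEmbedding_apply, Equiv.neg_apply]
  · have := hD e' he'
    omega
  · have := hB e' he'
    omega
  · rw [dvd_neg]
    exact hp e' he'

lemma sum_addChar_dotProduct (hψ : ψ ≠ 1) {k : ℕ} (v : Fin k → F) :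
    ∑ l : Fin k → F, ψ (∑ i, l i * v i) = if v = 0 then (Fintype.card F : ℂ) ^ k else 0 := by
  have h (l : Fin k → F) : ψ (∑ i, l i * v i) = ∏ i, ψ (l i * v i) :=
    map_prod ψ.toMonoidHom (fun i => Multiplicative.ofAdd (l i * v i)) Finset.univ
  simp only [h]
  rw [← Fintype.piFinset_univ, Finset.sum_prod_piFinset Finset.univ fun i x => ψ (x * v i)]
  simp only [AddChar.sum_mulShift _ (AddChar.IsPrimitive.of_ne_one hψ)]
  split_ifs with hv
  · simp [hv]
  · obtain ⟨i, hi⟩ := Function.ne_iff.mp hv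
    exact Finset.prod_eq_zero (Finset.mem_univ i) (by simpa using hi)

/-- If all nontrivial character sums of `t` are small, then `t` is nearly equidistributed. -/
lemma abs_card_div_sub_le {X : Type*} [Fintype X] [Nonempty X] {k : ℕ} (hψ : ψ ≠ 1)
    (t : X → Fin k → F) (a : Fin k → F) {C : ℝ}
    (ht : ∀ l : Fin k → F, l ≠ 0 → ‖∑ x, ψ (∑ i, l i * t x i)‖ ≤ Fintype.card X * C) (hC : 0 ≤ C) :
    |((Finset.univ.filter fun x => t x = a).card : ℝ) / Fintype.card X -
      ((Fintype.card F : ℝ) ^ k)⁻¹| ≤ C := by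
  set Q : ℝ := (Fintype.card F : ℝ) with hQ
  set S : ℝ := ((Finset.univ.filter fun x => t x = a).card : ℝ) with hS
  have hQ0 : 0 < Q ^ k := by
    have : 0 < Q := by rw [hQ]; exact_mod_cast Fintype.card_pos
    positivity
  have hX : (0 : ℝ) < Fintype.card X := by exact_mod_cast Fintype.card_pos
  have h1 : ∑ l : Fin k → F, ψ (-∑ i, l i * a i) * ∑ x, ψ (∑ i, l i * t x i) =
      (Q ^ k * S : ℝ) := by
    simp only [Finset.mul_sum]
    rw [Finset.sum_comm]
    have h (x : X) (l : Fin k → F) : ψ (-∑ i, l i * a i) * ψ (∑ i, l i * t x i) =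
        ψ (∑ i, l i * (t x - a) i) := by
      rw [← AddChar.map_add_eq_mul]
      congr 1
      simp only [Pi.sub_apply, mul_sub, Finset.sum_sub_distrib]
      ring
    simp only [h, sum_addChar_dotProduct hψ, sub_eq_zero]
    rw [← Finset.sum_filter, Finset.sum_const, nsmul_eq_mul, hS, hQ]
    push_cast
    ring
  rw [← Finset.add_sum_erase _ _ (Finset.mem_univ 0)] at h1
  have h2 : ‖∑ l ∈ Finset.univ.erase (0 : Fin k → F),
      ψ (-∑ i, l i * a i) * ∑ x, ψ (∑ i, l i * t x i)‖ ≤ Q ^ k * (Fintype.card X * C) := by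
    refine (norm_sum_le _ _).trans ?_
    calc _ ≤ ∑ l ∈ Finset.univ.erase (0 : Fin k → F), (Fintype.card X * C : ℝ) := by
          refine Finset.sum_le_sum fun l hl => ?_
          rw [norm_mul, AddChar.norm_apply, one_mul]
          exact ht l (Finset.ne_of_mem_erase hl)
      _ ≤ ∑ l : Fin k → F, (Fintype.card X * C : ℝ) :=
          Finset.sum_le_sum_of_subset_of_nonneg (Finset.erase_subset _ _) fun _ _ _ => by positivity
      _ = _ := by simp [hQ]
  have h3 : ∑ l ∈ Finset.univ.erase (0 : Fin k → F),
      ψ (-∑ i, l i * a i) * ∑ x, ψ (∑ i, l i * t x i) =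
        (Q ^ k * S - Fintype.card X : ℝ) := by
    push_cast
    push_cast at h1
    rw [← h1]
    simp
  rw [h3, Complex.norm_real, Real.norm_eq_abs] at h2
  have h4 : S / Fintype.card X - (Q ^ k)⁻¹ =
      (Q ^ k * S - Fintype.card X) / (Q ^ k * Fintype.card X) := by
    field_simp
  rw [h4, abs_div, abs_of_pos (mul_pos hQ0 hX), div_le_iff₀ (by positivity)]
  linarith

end Assembly

end TracePowers

/-- Gorodetsky–Rodgers bound with negative powers for `GL_n` over a finite field `F` with
`q` elements and odd characteristic `p`: for strictly increasing integers `b₁ < … < b_k`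
coprime with `p` and `d = max(b_k,0) − min(b₁,0) + 1`, for any `a₁,…,a_k ∈ F`, the
probability that a uniform `M ∈ GL_n(F)` has `tr(M^{b_i}) = a_i` for all `i` differs from
`q^{−k}` by at most `q^{−n²/(2d)} (1 + 1/(q−1))^n C(n+d,n)`. -/
theorem stmt_17 {F : Type*} [Field F] [Fintype F] (p : ℕ) [Fact p.Prime] (hp : Odd p)
    [CharP F p] (q : ℕ) (hq : q = Fintype.card F)
    (n k : ℕ) (hk : 1 ≤ k) (b : Fin k → ℤ) (hb : StrictMono b)
    (hbp : ∀ i : Fin k, ¬ (p : ℤ) ∣ b i)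
    (d : ℕ)
    (hd : (d : ℤ) = max (b ⟨k - 1, by omega⟩) 0 - min (b ⟨0, by omega⟩) 0 + 1)
    (a : Fin k → F) :
    |(({M : (Matrix (Fin n) (Fin n) F)ˣ | ∀ i : Fin k,
          Matrix.trace ((M ^ (b i) : (Matrix (Fin n) (Fin n) F)ˣ) :
            Matrix (Fin n) (Fin n) F) = a i}.ncard : ℝ) /
        (Nat.card (Matrix (Fin n) (Fin n) F)ˣ : ℝ) - (q : ℝ) ^ (-(k : ℝ)))| ≤
      (q : ℝ) ^ (-(n : ℝ) ^ 2 / (2 * (d : ℝ))) * (1 + 1 / ((q : ℝ) - 1)) ^ n *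
        (Nat.choose (n + d) n : ℝ) := by
  classical
  obtain ⟨ψ, hψ⟩ := AddChar.exists_apply_ne_zero.mpr (one_ne_zero (α := F))
  replace hψ : ψ ≠ 1 := by
    rintro rfl
    exact hψ rfl
  obtain ⟨D, hD⟩ := Int.eq_ofNat_of_zero_le (le_max_right (b ⟨k - 1, by omega⟩) 0)
  obtain ⟨B, hB⟩ := Int.eq_ofNat_of_zero_le (neg_nonneg.mpr (min_le_right (b ⟨0, by omega⟩) 0))
  have hdN : d = D + B + 1 := by omega
  have hq1 : (1 : ℝ) < q := by
    rw [hq]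
    exact_mod_cast Fintype.one_lt_card
  have hq0 : (0 : ℝ) < q - 1 := sub_pos.mpr hq1
  have hC0 : 0 ≤ TracePowers.meanBound q n (D + B) := by
    unfold TracePowers.meanBound
    positivity
  have key := TracePowers.abs_card_div_sub_le (X := (Matrix (Fin n) (Fin n) F)ˣ) hψ
    (fun M i => Matrix.trace (M ^ b i).1) a (C := TracePowers.meanBound q n (D + B)) ?_ hC0
  · rw [Real.rpow_neg (by positivity), Real.rpow_natCast, Nat.card_eq_fintype_card, hq]
    rw [← Set.ncard_coe_finset, Finset.coe_filter_univ] at key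
    simp only [funext_iff] at key
    refine key.trans ?_
    rw [TracePowers.meanBound, hq, hdN]
    rw [hq] at hq0
    calc _ = (Fintype.card F : ℝ) ^ (-(n : ℝ) ^ 2 / (2 * ((D + B : ℕ) + 1))) *
        (1 + 1 / ((Fintype.card F : ℝ) - 1)) ^ n * (n + (D + B)).choose n := by ring
      _ ≤ _ := by
        push_cast
        gcongr ?_ * ?_ * ?_
        exact_mod_cast Nat.choose_le_choose n (by omega)
  · intro l hl
    have hsupp : ∀ e ∈ ((Finsupp.equivFunOnFinite.symm l).embDomain ⟨b, hb.injective⟩).support,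
        ∃ i, b i = e := by
      intro e he
      rw [Finsupp.support_embDomain, Finset.mem_map] at he
      obtain ⟨i, _, hi⟩ := he
      exact ⟨i, hi⟩
    have h := TracePowers.norm_traceSum_le (p := p) (B := B) (D := D) hψ
      (c := (Finsupp.equivFunOnFinite.symm l).embDomain ⟨b, hb.injective⟩) ?_ ?_ ?_ ?_ n
    · rw [TracePowers.traceSum, Nat.card_eq_fintype_card] at h
      simp only [Finsupp.sum_embDomain] at h
      simpa [Finsupp.sum_fintype, hq] using h
    · rw [Ne, Finsupp.embDomain_eq_zero, Equiv.symm_apply_eq]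
      exact hl
    · intro e he
      obtain ⟨i, rfl⟩ := hsupp e he
      have : b ⟨0, by omega⟩ ≤ b i := hb.monotone (Fin.mk_le_of_le_val (Nat.zero_le _))
      omega
    · intro e he
      obtain ⟨i, rfl⟩ := hsupp e he
      have : b i ≤ b ⟨k - 1, by omega⟩ := hb.monotone (Fin.le_def.mpr (by simp; omega))
      omega
    · intro e he
      obtain ⟨i, rfl⟩ := hsupp e he
      exact hbp i
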